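/- arXiv:2304.08696 — 5 statements merged into one kernel-verified Lean document; each statement's English description precedes it below -/
import Mathlib

section
/- Let U_s be a shear flow with decay rate η₀, let c ∈ ℂ satisfy inf_{y≥0}|U_s(y) − c| > 0, and let α > 0. For every n ∈ ℕ there exists y_n ≥ 0 and λ ∈ (0,1) such that for all ȳ ≥ y_n and all φ ∈ W^∞_{n,α;ȳ} one has ‖T_{α;ȳ}φ‖_{n,α;ȳ} ≤ λ‖φ‖_{n,α;ȳ}, and for all φ ∈ W^∞_{n,−α;ȳ} one has ‖T_{α;ȳ}φ‖_{n,−α;ȳ} ≤ λ‖φ‖_{n,−α;ȳ}. -/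
open MeasureTheory Filter Set

noncomputable section

/-- `Δ_α φ = φ'' − α² φ`. -/
def DeltaA (α : ℝ) (φ : ℝ → ℂ) : ℝ → ℂ :=
  fun y => deriv (deriv φ) y - (α : ℂ) ^ 2 * φ y

/-- The Rayleigh operator `Ray_c φ = (U − c) Δ_α φ − U'' φ`. -/
def Ray (U : ℝ → ℝ) (α : ℝ) (c : ℂ) (φ : ℝ → ℂ) : ℝ → ℂ :=
  fun y => ((U y : ℂ) - c) * DeltaA α φ y - ((deriv (deriv U) y : ℝ) : ℂ) * φ y

/-- The adjoint Rayleigh operator `Ray*_c φ = (U − conj c) Δ_α φ + 2 U' φ'`. -/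
def RayStar (U : ℝ → ℝ) (α : ℝ) (c : ℂ) (φ : ℝ → ℂ) : ℝ → ℂ :=
  fun y => ((U y : ℂ) - (starRingEnd ℂ) c) * DeltaA α φ y + 2 * ((deriv U y : ℝ) : ℂ) * deriv φ y

/-- A shear flow with decay rate `η₀`: smooth, bounded, vanishing at the origin with its
first two derivatives, with a finite limit at `+∞` and exponentially decaying derivatives. -/
def ShearFlow (U : ℝ → ℝ) (η₀ : ℝ) : Prop :=
  ContDiff ℝ (⊤ : ℕ∞) U ∧ (∃ M : ℝ, ∀ y : ℝ, |U y| ≤ M) ∧ U 0 = 0 ∧ deriv U 0 = 0 ∧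
    deriv (deriv U) 0 = 0 ∧ (∃ L : ℝ, Tendsto U atTop (nhds L)) ∧ 0 < η₀ ∧
    (∀ k : ℕ, 1 ≤ k → ∃ C : ℝ, 0 < C ∧ ∀ y : ℝ, 0 ≤ y →
      |iteratedDeriv k U y| ≤ C * Real.exp (-η₀ * y))

/-- The integral operator `T_{α;ȳ} φ(y) = (2α(U(y)−conj c))⁻¹ ∫_ȳ^∞ e^{−α|y−x|} U''(x) φ(x) dx`. -/
def Talpha (U : ℝ → ℝ) (α ybar : ℝ) (c : ℂ) (φ : ℝ → ℂ) : ℝ → ℂ :=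
  fun y => (2 * (α : ℂ) * ((U y : ℂ) - (starRingEnd ℂ) c))⁻¹ *
    ∫ x in Set.Ioi ybar,
      ((Real.exp (-(α * |y - x|)) : ℝ) : ℂ) * ((deriv (deriv U) x : ℝ) : ℂ) * φ x

open scoped Topology

lemma aux_endpoint (f : ℝ → ℂ) (W : ℝ → ℝ) (a : ℝ) (hW : Continuous W) (hWa : 0 ≤ W a)
    (hd : ∀ y, a < y → DifferentiableAt ℝ f y) (hb : ∀ y, a < y → ‖deriv f y‖ ≤ W y) :
    ‖deriv f a‖ ≤ W a := by
  by_cases hda : DifferentiableAt ℝ f a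
  swap
  · rw [deriv_zero_of_not_differentiableAt hda]; simpa using hWa
  refine le_of_forall_pos_le_add fun ε hε => ?_
  have h1 : ∀ᶠ y in 𝓝 a, W y < W a + ε := hW.continuousAt.eventually_lt_const (by linarith)
  obtain ⟨δ, hδ, h2⟩ := Metric.eventually_nhds_iff.1 h1
  have h3 : ∀ x ∈ Ioo a (a + δ), ∀ y ∈ Ioo a (a + δ), ‖f y - f x‖ ≤ (W a + ε) * ‖y - x‖ := by
    intro x hx y hy
    refine Convex.norm_image_sub_le_of_norm_deriv_le (s := Ioo a (a + δ))
      (fun z hz => hd z hz.1) (fun z hz => ?_) (convex_Ioo _ _) hx hy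
    refine (hb z hz.1).trans (h2 ?_).le
    rw [Real.dist_eq, abs_lt]; constructor <;> linarith [hz.1, hz.2]
  have hI : Ioo a (a + δ) ∈ 𝓝[>] a := Ioo_mem_nhdsGT (by linarith)
  have h4 : ∀ y ∈ Ioo a (a + δ), ‖f y - f a‖ ≤ (W a + ε) * ‖y - a‖ := by
    intro y hy
    have hc : Tendsto (fun x => ‖f y - f x‖) (𝓝[>] a) (𝓝 ‖f y - f a‖) :=
      ((tendsto_const_nhds.sub hda.continuousAt.tendsto).norm).mono_left nhdsWithin_le_nhds
    have hc2 : Tendsto (fun x => (W a + ε) * ‖y - x‖) (𝓝[>] a) (𝓝 ((W a + ε) * ‖y - a‖)) :=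
      (Continuous.tendsto (by fun_prop) a).mono_left nhdsWithin_le_nhds
    refine le_of_tendsto_of_tendsto hc hc2 ?_
    filter_upwards [hI] with x hx using h3 x hx y hy
  have h5 := (hasDerivWithinAt_iff_tendsto_slope' (s := Ioi a) (by simp)).1
    hda.hasDerivAt.hasDerivWithinAt
  refine le_of_tendsto h5.norm ?_
  filter_upwards [hI] with y hy
  have hya : 0 < y - a := by linarith [hy.1]
  have := h4 y hy
  rw [slope_def_module, norm_smul, norm_inv, Real.norm_of_nonneg hya.le]
  rw [Real.norm_of_nonneg hya.le] at this
  rw [inv_mul_le_iff₀ hya]; linarith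

lemma aux_ofReal (U : ℝ → ℝ) (hU : ContDiff ℝ (⊤ : ℕ∞) U) (k : ℕ) :
    iteratedDeriv k (fun y => (U y : ℂ)) = fun y => ((iteratedDeriv k U y : ℝ) : ℂ) := by
  induction k with
  | zero => simp
  | succ k ih =>
    rw [iteratedDeriv_succ, ih, iteratedDeriv_succ]
    ext y
    have hd : Differentiable ℝ (iteratedDeriv k U) :=
      hU.differentiable_iteratedDeriv k (by exact_mod_cast WithTop.coe_lt_top k)
    exact (hd y).hasDerivAt.ofReal_comp.deriv

lemma aux_ofReal_smooth (U : ℝ → ℝ) (hU : ContDiff ℝ (⊤ : ℕ∞) U) (n : ℕ) :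
    ContDiff ℝ n (fun y => (U y : ℂ)) := by
  have : ContDiff ℝ (n : WithTop ℕ∞) U := hU.of_le (by exact_mod_cast le_top)
  exact Complex.ofRealCLM.contDiff.comp this

/-- bounds on the reciprocal -/
lemma aux_recip (V : ℝ → ℂ) (hV : ∀ n : ℕ, ContDiff ℝ n V) (δ : ℝ) (hδ : 0 < δ)
    (hVδ : ∀ y, 0 < y → δ ≤ ‖V y‖)
    (hb : ∀ k, 1 ≤ k → ∃ C : ℝ, 0 ≤ C ∧ ∀ y, 0 < y → ‖iteratedDeriv k V y‖ ≤ C) (k : ℕ) :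
    ∃ C : ℝ, 0 ≤ C ∧ ∀ y, 0 < y → ‖iteratedDeriv k (fun y => (V y)⁻¹) y‖ ≤ C := by
  induction k using Nat.strong_induction_on with
  | _ k ih =>
  have hne : ∀ y, 0 < y → V y ≠ 0 := fun y hy h => by
    have := hVδ y hy; rw [h, norm_zero] at this; linarith
  rcases Nat.eq_zero_or_pos k with rfl | hk
  · refine ⟨δ⁻¹, by positivity, fun y hy => ?_⟩
    simp only [iteratedDeriv_zero, norm_inv]
    exact inv_anti₀ hδ (hVδ y hy)
  · choose! CK hCK0 hCK using ih
    choose! CV hCV0 hCV using hb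
    refine ⟨δ⁻¹ * ∑ i ∈ Finset.range k, (k.choose i : ℝ) * CK i * CV (k - i), ?_, fun y hy => ?_⟩
    · refine mul_nonneg (by positivity) (Finset.sum_nonneg fun i hi => ?_)
      have hi' := Finset.mem_range.1 hi
      exact mul_nonneg (mul_nonneg (by positivity) (hCK0 i hi')) (hCV0 _ (by omega))
    · have e1 : (fun y => (V y)⁻¹ * V y) =ᶠ[𝓝 y] fun _ => (1 : ℂ) := by
        filter_upwards [Ioi_mem_nhds hy] with z hz
        exact inv_mul_cancel₀ (hne z hz)
      have e2 := e1.iteratedDeriv_eq k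
      rw [iteratedDeriv_const, if_neg (by omega), iteratedDeriv_fun_mul (f := fun y => (V y)⁻¹)
        ((hV k).contDiffAt.inv (hne y hy)) (hV k).contDiffAt, Finset.sum_range_succ] at e2
      simp only [Nat.choose_self, Nat.cast_one, one_mul, Nat.sub_self, iteratedDeriv_zero] at e2
      have e3 : ‖iteratedDeriv k (fun y => (V y)⁻¹) y‖ * ‖V y‖ ≤
          ∑ i ∈ Finset.range k, (k.choose i : ℝ) * CK i * CV (k - i) := by
        rw [← norm_mul, ← norm_neg, ← eq_neg_of_add_eq_zero_left e2]
        refine norm_sum_le_of_le _ fun i hi => ?_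
        have hi' := Finset.mem_range.1 hi
        rw [norm_mul, norm_mul, Complex.norm_natCast]
        have := hCK i hi' y hy
        have := hCV (k - i) (by omega) y hy
        have := hCK0 i hi'
        gcongr
      rw [le_inv_mul_iff₀ hδ]
      refine le_trans ?_ e3
      rw [mul_comm]
      exact mul_le_mul_of_nonneg_left (hVδ y hy) (norm_nonneg _)

/-- exponential factor -/
def eC (α x : ℝ) : ℂ := ((Real.exp (α * x) : ℝ) : ℂ)

lemma eC_norm (α x : ℝ) : ‖eC α x‖ = Real.exp (α * x) := by
  rw [eC, Complex.norm_real, Real.norm_of_nonneg (Real.exp_pos _).le]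

lemma eC_cont (α : ℝ) : Continuous (eC α) := by unfold eC; fun_prop

lemma eC_deriv (α x : ℝ) : HasDerivAt (eC α) (α * eC α x) x := by
  have h : HasDerivAt (fun x => Real.exp (α * x)) (α * Real.exp (α * x)) x := by
    have := ((hasDerivAt_id x).const_mul α).exp
    simpa [mul_comm] using this
  have h2 := h.ofReal_comp
  rw [Complex.ofReal_mul] at h2
  exact h2

lemma eC_mul (α x : ℝ) : eC (-α) x * eC α x = 1 := by
  unfold eC; rw [← Complex.ofReal_mul, ← Real.exp_add]; simp

def Apart (α a : ℝ) (g : ℝ → ℂ) (y : ℝ) : ℂ := eC (-α) y * ∫ x in a..y, eC α x * g x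
def Bpart (α a : ℝ) (g : ℝ → ℂ) (y : ℝ) : ℂ :=
  eC α y * ((∫ x in Ioi a, eC (-α) x * g x) - ∫ x in a..y, eC (-α) x * g x)
def Itil (α a : ℝ) (g : ℝ → ℂ) (y : ℝ) : ℂ := Apart α a g y + Bpart α a g y

lemma Apart_deriv (α a : ℝ) (g : ℝ → ℂ) (hg : Continuous g) (y : ℝ) :
    HasDerivAt (Apart α a g) (-α * Apart α a g y + g y) y := by
  have hc : Continuous fun x => eC α x * g x := (eC_cont α).mul hg
  have h1 : HasDerivAt (fun y => ∫ x in a..y, eC α x * g x) (eC α y * g y) y :=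
    intervalIntegral.integral_hasDerivAt_right (hc.intervalIntegrable _ _)
      (hc.stronglyMeasurableAtFilter _ _) hc.continuousAt
  have h2 := (eC_deriv (-α) y).mul h1
  refine h2.congr_deriv ?_
  have := eC_mul α y
  unfold Apart
  push_cast
  linear_combination g y * this

lemma Bpart_deriv (α a : ℝ) (g : ℝ → ℂ) (hg : Continuous g) (y : ℝ) :
    HasDerivAt (Bpart α a g) (α * Bpart α a g y - g y) y := by
  have hc : Continuous fun x => eC (-α) x * g x := (eC_cont _).mul hg
  have h1 : HasDerivAt (fun y => ∫ x in a..y, eC (-α) x * g x) (eC (-α) y * g y) y :=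
    intervalIntegral.integral_hasDerivAt_right (hc.intervalIntegrable _ _)
      (hc.stronglyMeasurableAtFilter _ _) hc.continuousAt
  have h2 := (eC_deriv α y).mul (h1.const_sub (∫ x in Ioi a, eC (-α) x * g x))
  refine h2.congr_deriv ?_
  have := eC_mul α y
  unfold Bpart
  linear_combination - g y * this

lemma Itil_deriv (α a : ℝ) (g : ℝ → ℂ) (hg : Continuous g) :
    deriv (Itil α a g) = fun y => α * (Bpart α a g y - Apart α a g y) := by
  ext y
  have := (Apart_deriv α a g hg y).add (Bpart_deriv α a g hg y)
  refine (this.congr_deriv ?_).deriv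
  ring

lemma Itil_diff (α a : ℝ) (g : ℝ → ℂ) (hg : Continuous g) : Differentiable ℝ (Itil α a g) :=
  fun y => ((Apart_deriv α a g hg y).add (Bpart_deriv α a g hg y)).differentiableAt

lemma Itil_diff1 (α a : ℝ) (g : ℝ → ℂ) (hg : Continuous g) :
    Differentiable ℝ (deriv (Itil α a g)) := by
  rw [Itil_deriv α a g hg]
  exact fun y => (((Bpart_deriv α a g hg y).sub (Apart_deriv α a g hg y)).const_mul
    (α : ℂ)).differentiableAt

lemma Itil_deriv2 (α a : ℝ) (g : ℝ → ℂ) (hg : Continuous g) :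
    deriv (deriv (Itil α a g)) = fun y => (α : ℂ) ^ 2 * Itil α a g y - 2 * α * g y := by
  rw [Itil_deriv α a g hg]
  ext y
  have := ((Bpart_deriv α a g hg y).sub (Apart_deriv α a g hg y)).const_mul (α : ℂ)
  refine (this.congr_deriv ?_).deriv
  unfold Itil
  ring

lemma Itil_smooth (α a : ℝ) (g : ℝ → ℂ) (n : ℕ) (hg : ContDiff ℝ n g) (k : ℕ) (hk : k ≤ n) :
    ContDiff ℝ k (Itil α a g) := by
  induction k with
  | zero => exact_mod_cast contDiff_zero.2 (Itil_diff α a g hg.continuous).continuous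
  | succ k ih =>
    have h1 := ih (by omega)
    have hgk : ContDiff ℝ k g := hg.of_le (by exact_mod_cast (by omega : k ≤ n))
    have h2 : ContDiff ℝ k (deriv (deriv (Itil α a g))) := by
      rw [Itil_deriv2 α a g hg.continuous]
      exact (contDiff_const.mul h1).sub (contDiff_const.mul hgk)
    have h3 : ContDiff ℝ ((k : WithTop ℕ∞) + 1) (deriv (Itil α a g)) :=
      contDiff_succ_iff_deriv.2 ⟨Itil_diff1 α a g hg.continuous, by simp, h2⟩
    have h4 : ContDiff ℝ ((k : WithTop ℕ∞) + 1) (Itil α a g) :=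
      contDiff_succ_iff_deriv.2 ⟨Itil_diff α a g hg.continuous, by simp,
        h3.of_le le_self_add⟩
    exact_mod_cast h4

/-- Integral of decaying bound. -/
lemma aux_int (η : ℝ) (hη : 0 < η) (B a : ℝ) :
    ∫ x in Ioi a, B * Real.exp (-η * x) = B * (Real.exp (-η * a) / η) := by
  rw [integral_const_mul, integral_exp_mul_Ioi (by linarith)]
  congr 1
  rw [div_neg, neg_div, neg_neg]

lemma aux_intble (η : ℝ) (hη : 0 < η) (B a : ℝ) :
    IntegrableOn (fun x => B * Real.exp (-η * x)) (Ioi a) :=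
  (exp_neg_integrableOn_Ioi a hη).const_mul B

lemma aux_B_int (α a η s B : ℝ) (hη : 0 < η) (hB : 0 ≤ B) (hs : |s| ≤ α) (g : ℝ → ℂ)
    (hg : Continuous g) (y : ℝ) (hy : a ≤ y)
    (hb : ∀ x, a ≤ x → ‖g x‖ ≤ B * (Real.exp (-η * x) * Real.exp (-s * x))) :
    IntegrableOn (fun x => eC (-α) x * g x) (Ioi y) ∧
    ‖∫ x in Ioi y, eC (-α) x * g x‖ ≤
      (B * Real.exp (-(α + s) * y)) * (Real.exp (-η * y) / η) := by
  have hs' := abs_le.1 hs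
  have hle : ∀ᵐ x ∂(volume.restrict (Ioi y)),
      ‖eC (-α) x * g x‖ ≤ (B * Real.exp (-(α + s) * y)) * Real.exp (-η * x) := by
    filter_upwards [ae_restrict_mem measurableSet_Ioi] with x hx
    have hx : y < x := hx
    rw [norm_mul, eC_norm]
    have h1 := hb x (by linarith)
    have h2 : Real.exp (-α * x) * Real.exp (-s * x) ≤ Real.exp (-(α + s) * y) := by
      rw [← Real.exp_add]; apply Real.exp_le_exp.2; nlinarith
    calc Real.exp (-α * x) * ‖g x‖
        ≤ Real.exp (-α * x) * (B * (Real.exp (-η * x) * Real.exp (-s * x))) := by gcongr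
      _ = B * (Real.exp (-α * x) * Real.exp (-s * x)) * Real.exp (-η * x) := by ring
      _ ≤ _ := by gcongr
  have hi := aux_intble η hη (B * Real.exp (-(α + s) * y)) y
  refine ⟨Integrable.mono' hi ((eC_cont _).mul hg).aestronglyMeasurable hle, ?_⟩
  rw [← aux_int η hη]
  exact MeasureTheory.norm_integral_le_of_norm_le hi hle

lemma Bpart_eq (α a η s B : ℝ) (hη : 0 < η) (hB : 0 ≤ B) (hs : |s| ≤ α) (g : ℝ → ℂ)
    (hg : Continuous g) (y : ℝ) (hy : a ≤ y)
    (hb : ∀ x, a ≤ x → ‖g x‖ ≤ B * (Real.exp (-η * x) * Real.exp (-s * x))) :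
    Bpart α a g y = eC α y * ∫ x in Ioi y, eC (-α) x * g x := by
  have h1 := (aux_B_int α a η s B hη hB hs g hg a le_rfl hb).1
  have h2 := (aux_B_int α a η s B hη hB hs g hg y hy hb).1
  unfold Bpart
  rw [← intervalIntegral.integral_interval_add_Ioi h1 h2]
  ring

lemma Bpart_bound (α a η s B : ℝ) (hη : 0 < η) (hB : 0 ≤ B) (hs : |s| ≤ α) (g : ℝ → ℂ)
    (hg : Continuous g) (y : ℝ) (hy : a ≤ y)
    (hb : ∀ x, a ≤ x → ‖g x‖ ≤ B * (Real.exp (-η * x) * Real.exp (-s * x))) :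
    ‖Bpart α a g y‖ ≤ B / η * (Real.exp (-η * a) * Real.exp (-s * y)) := by
  rw [Bpart_eq α a η s B hη hB hs g hg y hy hb, norm_mul, eC_norm]
  have h := (aux_B_int α a η s B hη hB hs g hg y hy hb).2
  calc _ ≤ Real.exp (α * y) * ((B * Real.exp (-(α + s) * y)) * (Real.exp (-η * y) / η)) := by gcongr
    _ = B / η * (Real.exp (-η * y) * (Real.exp (α * y) * Real.exp (-(α + s) * y))) := by ring
    _ = B / η * (Real.exp (-η * y) * Real.exp (-s * y)) := by
      rw [← Real.exp_add]; ring_nf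
    _ ≤ _ := by
      have : Real.exp (-η * y) ≤ Real.exp (-η * a) := Real.exp_le_exp.2 (by nlinarith)
      gcongr

lemma Apart_bound (α a η s B : ℝ) (hη : 0 < η) (hB : 0 ≤ B) (hs : |s| ≤ α) (g : ℝ → ℂ)
    (y : ℝ) (hy : a ≤ y)
    (hb : ∀ x, a ≤ x → ‖g x‖ ≤ B * (Real.exp (-η * x) * Real.exp (-s * x))) :
    ‖Apart α a g y‖ ≤ B / η * (Real.exp (-η * a) * Real.exp (-s * y)) := by
  have hs' := abs_le.1 hs
  have h : ‖∫ x in a..y, eC α x * g x‖ ≤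
      (B * Real.exp ((α - s) * y)) * (Real.exp (-η * a) / η) := by
    have hi := aux_intble η hη (B * Real.exp ((α - s) * y)) a
    have h1 : ‖∫ x in a..y, eC α x * g x‖ ≤
        ∫ x in a..y, (B * Real.exp ((α - s) * y)) * Real.exp (-η * x) := by
      refine intervalIntegral.norm_integral_le_of_norm_le hy ?_
        (Continuous.intervalIntegrable (by fun_prop) _ _)
      refine Eventually.of_forall fun x hx => ?_
      rw [norm_mul, eC_norm]
      have h1 := hb x hx.1.le
      have h2 : Real.exp (α * x) * Real.exp (-s * x) ≤ Real.exp ((α - s) * y) := by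
        rw [← Real.exp_add]; apply Real.exp_le_exp.2; nlinarith [hx.2]
      calc Real.exp (α * x) * ‖g x‖
          ≤ Real.exp (α * x) * (B * (Real.exp (-η * x) * Real.exp (-s * x))) := by gcongr
        _ = B * (Real.exp (α * x) * Real.exp (-s * x)) * Real.exp (-η * x) := by ring
        _ ≤ _ := by gcongr
    refine h1.trans ?_
    rw [← aux_int η hη, intervalIntegral.integral_of_le hy]
    refine setIntegral_mono_set hi (Eventually.of_forall fun x => ?_)
      (Ioc_subset_Ioi_self.eventuallyLE)
    simp only [Pi.zero_apply]; positivity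
  unfold Apart
  rw [norm_mul, eC_norm]
  calc _ ≤ Real.exp (-α * y) * ((B * Real.exp ((α - s) * y)) * (Real.exp (-η * a) / η)) := by gcongr
    _ = B / η * (Real.exp (-η * a) * (Real.exp (-α * y) * Real.exp ((α - s) * y))) := by ring
    _ = B / η * (Real.exp (-η * a) * Real.exp (-s * y)) := by
      rw [← Real.exp_add]; ring_nf

lemma Itil_eq (α a η s B : ℝ) (hη : 0 < η) (hB : 0 ≤ B) (hs : |s| ≤ α) (g : ℝ → ℂ)
    (hg : Continuous g) (y : ℝ) (hy : a ≤ y)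
    (hb : ∀ x, a ≤ x → ‖g x‖ ≤ B * (Real.exp (-η * x) * Real.exp (-s * x))) :
    ∫ x in Ioi a, ((Real.exp (-(α * |y - x|)) : ℝ) : ℂ) * g x = Itil α a g y := by
  have h2 := (aux_B_int α a η s B hη hB hs g hg y hy hb).1
  have hB' : ∀ x ∈ Ioi y, ((Real.exp (-(α * |y - x|)) : ℝ) : ℂ) * g x
      = eC α y * (eC (-α) x * g x) := by
    intro x hx
    have hx : y < x := hx
    rw [← mul_assoc, eC, eC, ← Complex.ofReal_mul, ← Real.exp_add, abs_of_neg (by linarith)]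
    ring_nf
  have hA' : ∀ x ∈ Ioc a y, ((Real.exp (-(α * |y - x|)) : ℝ) : ℂ) * g x
      = eC (-α) y * (eC α x * g x) := by
    intro x hx
    rw [← mul_assoc, eC, eC, ← Complex.ofReal_mul, ← Real.exp_add,
      abs_of_nonneg (by linarith [hx.2])]
    ring_nf
  have hcont : Continuous fun x => ((Real.exp (-(α * |y - x|)) : ℝ) : ℂ) * g x := by fun_prop
  have hi2 : IntegrableOn (fun x => ((Real.exp (-(α * |y - x|)) : ℝ) : ℂ) * g x) (Ioi y) :=
    IntegrableOn.congr_fun (f := fun x => eC α y * (eC (-α) x * g x)) (h2.const_mul (eC α y)) (fun x hx => (hB' x hx).symm) measurableSet_Ioi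
  rw [← intervalIntegral.integral_interval_add_Ioi' (hcont.intervalIntegrable a y) hi2,
    setIntegral_congr_fun measurableSet_Ioi hB', intervalIntegral.integral_of_le hy,
    setIntegral_congr_fun measurableSet_Ioc hA', integral_const_mul, integral_const_mul,
    Itil, Bpart_eq α a η s B hη hB hs g hg y hy hb, Apart, intervalIntegral.integral_of_le hy]

lemma aux_prod_bound (f h : ℝ → ℂ) (j : ℕ) (y : ℝ) (hf : ContDiffAt ℝ j f y)
    (hh : ContDiffAt ℝ j h y) (F H : ℕ → ℝ) (X Y : ℝ) (hF0 : ∀ i, 0 ≤ F i) (hX : 0 ≤ X)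
    (hF : ∀ i ≤ j, ‖iteratedDeriv i f y‖ ≤ F i * X)
    (hH : ∀ i ≤ j, ‖iteratedDeriv i h y‖ ≤ H i * Y) :
    ‖iteratedDeriv j (fun y => f y * h y) y‖ ≤
      (∑ i ∈ Finset.range (j + 1), (j.choose i : ℝ) * F i * H (j - i)) * (X * Y) := by
  rw [iteratedDeriv_fun_mul hf hh, Finset.sum_mul]
  refine norm_sum_le_of_le _ fun i hi => ?_
  have hi' := Finset.mem_range.1 hi
  rw [norm_mul, norm_mul, Complex.norm_natCast]
  have h1 := hF i (by omega)
  have h2 := hH (j - i) (by omega)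
  have h3 := hF0 i
  calc (j.choose i : ℝ) * ‖iteratedDeriv i f y‖ * ‖iteratedDeriv (j - i) h y‖
      ≤ (j.choose i : ℝ) * (F i * X) * (H (j - i) * Y) := by gcongr
    _ = _ := by ring

lemma Itil_bound (α η : ℝ) (hα : 0 < α) (hη : 0 < η) (G : ℕ → ℝ) (hG : ∀ i, 0 ≤ G i) (j : ℕ) :
    ∃ D : ℝ, 0 ≤ D ∧ ∀ (a s M : ℝ) (n : ℕ) (g : ℝ → ℂ), |s| ≤ α → 0 ≤ M → j ≤ n →
      ContDiff ℝ n g →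
      (∀ i ≤ n, ∀ y, a ≤ y →
        ‖iteratedDeriv i g y‖ ≤ G i * M * (Real.exp (-η * y) * Real.exp (-s * y))) →
      ∀ y, a ≤ y → ‖iteratedDeriv j (Itil α a g) y‖ ≤
        D * (M * (Real.exp (-η * a) * Real.exp (-s * y))) := by
  induction j using Nat.twoStepInduction with
  | zero =>
    refine ⟨2 * (G 0 / η), by have := hG 0; positivity, ?_⟩
    intro a s M n g hs hM hj hg hb y hy
    have hb0 := hb 0 (by omega)
    simp only [iteratedDeriv_zero] at hb0 ⊢
    have h1 := Apart_bound α a η s (G 0 * M) hη (mul_nonneg (hG 0) hM) hs g y hy hb0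
    have h2 := Bpart_bound α a η s (G 0 * M) hη (mul_nonneg (hG 0) hM) hs g hg.continuous y hy hb0
    refine (norm_add_le _ _).trans ((add_le_add h1 h2).trans (le_of_eq ?_))
    ring
  | one =>
    refine ⟨α * (2 * (G 0 / η)), by have := hG 0; positivity, ?_⟩
    intro a s M n g hs hM hj hg hb y hy
    have hb0 := hb 0 (by omega)
    simp only [iteratedDeriv_zero] at hb0
    have h1 := Apart_bound α a η s (G 0 * M) hη (mul_nonneg (hG 0) hM) hs g y hy hb0
    have h2 := Bpart_bound α a η s (G 0 * M) hη (mul_nonneg (hG 0) hM) hs g hg.continuous y hy hb0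
    rw [iteratedDeriv_one, Itil_deriv α a g hg.continuous, norm_mul, Complex.norm_real,
      Real.norm_of_nonneg hα.le, mul_assoc α]
    refine mul_le_mul_of_nonneg_left ?_ hα.le
    refine (norm_sub_le _ _).trans ((add_le_add h2 h1).trans (le_of_eq ?_))
    ring
  | more j ih _ =>
    obtain ⟨D, hD, h⟩ := ih
    refine ⟨α ^ 2 * D + 2 * α * G j, by have := hG j; positivity, ?_⟩
    intro a s M n g hs hM hj hg hb y hy
    have h1 := h a s M n g hs hM (by omega) hg hb y hy
    have h2 := hb j (by omega) y hy
    have hgj : ContDiff ℝ j g := hg.of_le (by exact_mod_cast (by omega : j ≤ n))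
    have hIj := Itil_smooth α a g n hg j (by omega)
    rw [iteratedDeriv_succ', iteratedDeriv_succ', Itil_deriv2 α a g hg.continuous,
      iteratedDeriv_fun_sub (contDiff_const.mul hIj).contDiffAt
        (contDiff_const.mul hgj).contDiffAt,
      iteratedDeriv_const_mul_field, iteratedDeriv_const_mul_field]
    refine (norm_sub_le _ _).trans ?_
    simp only [norm_mul, norm_pow, Complex.norm_real, Real.norm_of_nonneg hα.le, Complex.norm_ofNat]
    have h3 : Real.exp (-η * y) ≤ Real.exp (-η * a) := Real.exp_le_exp.2 (by nlinarith)
    have h4 := hG j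
    calc _ ≤ α ^ 2 * (D * (M * (Real.exp (-η * a) * Real.exp (-s * y)))) +
          2 * α * (G j * M * (Real.exp (-η * a) * Real.exp (-s * y))) := by
            gcongr
            exact h2.trans (by gcongr)
      _ = _ := by ring

lemma aux_core (U : ℝ → ℝ) (η₀ : ℝ) (hU : ShearFlow U η₀) (c : ℂ)
    (hc : ∃ δ : ℝ, 0 < δ ∧ ∀ y : ℝ, 0 ≤ y → δ ≤ ‖(U y : ℂ) - c‖)
    (α : ℝ) (hα : 0 < α) (n : ℕ) :
    ∃ E : ℝ, 0 ≤ E ∧ ∀ a : ℝ, 0 ≤ a → ∀ s : ℝ, |s| ≤ α → ∀ φ : ℝ → ℂ, ContDiff ℝ n φ →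
      ∀ M : ℝ, 0 ≤ M → (∀ j ≤ n, ∀ y : ℝ, a ≤ y → ‖iteratedDeriv j φ y‖ ≤ M * Real.exp (-s * y)) →
      ContDiffOn ℝ n (Talpha U α a c φ) (Ioi a) ∧
      (∀ y, a ≤ y → ‖Talpha U α a c φ y‖ ≤ E * (M * (Real.exp (-η₀ * a) * Real.exp (-s * y)))) ∧
      ∀ j ≤ n, ∀ y, a < y → ‖iteratedDeriv j (Talpha U α a c φ) y‖ ≤
        E * (M * (Real.exp (-η₀ * a) * Real.exp (-s * y))) := by
  obtain ⟨hUs, -, -, -, -, -, hη, hdec⟩ := hU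
  obtain ⟨δ, hδ, hcδ⟩ := hc
  choose! Cd hCd0 hCd using hdec
  set V : ℝ → ℂ := fun y => 2 * (α : ℂ) * ((U y : ℂ) - (starRingEnd ℂ) c) with hVdef
  have hVs : ∀ n : ℕ, ContDiff ℝ n V := fun n =>
    contDiff_const.mul ((aux_ofReal_smooth U hUs n).sub contDiff_const)
  have hVδ : ∀ y, 0 ≤ y → 2 * α * δ ≤ ‖V y‖ := by
    intro y hy
    have h1 : ‖(U y : ℂ) - (starRingEnd ℂ) c‖ = ‖(U y : ℂ) - c‖ := by
      rw [← Complex.norm_conj, map_sub, Complex.conj_conj, Complex.conj_ofReal]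
    rw [hVdef]
    simp only [norm_mul, h1, Complex.norm_real, Real.norm_of_nonneg hα.le, Complex.norm_ofNat]
    have := hcδ y hy
    gcongr
  have hVb : ∀ k, 1 ≤ k → ∃ C : ℝ, 0 ≤ C ∧ ∀ y, 0 < y → ‖iteratedDeriv k V y‖ ≤ C := by
    intro k hk
    refine ⟨2 * α * Cd k, by have := hCd0 k hk; positivity, fun y hy => ?_⟩
    rw [hVdef, iteratedDeriv_const_mul_field, iteratedDeriv_fun_sub
      (aux_ofReal_smooth U hUs k).contDiffAt contDiff_const.contDiffAt, aux_ofReal U hUs,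
      iteratedDeriv_const, if_neg (by omega), sub_zero]
    simp only [norm_mul, Complex.norm_real, Real.norm_of_nonneg hα.le, Complex.norm_ofNat]
    have h1 := hCd k hk y hy.le
    have h2 : Real.exp (-η₀ * y) ≤ 1 := Real.exp_le_one_iff.2 (by nlinarith)
    have h3 := hCd0 k hk
    rw [Real.norm_eq_abs]
    have h4 : |iteratedDeriv k U y| ≤ Cd k := h1.trans (by nlinarith)
    gcongr
  choose FK hFK0 hFK using aux_recip V hVs (2 * α * δ) (by positivity)
    (fun y hy => hVδ y hy.le) hVb
  have hVne : ∀ y, 0 ≤ y → V y ≠ 0 := fun y hy h => by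
    have := hVδ y hy
    rw [h, norm_zero] at this
    have : 0 < 2 * α * δ := by positivity
    linarith
  -- the source term
  have hU2 : ContDiff ℝ (⊤ : ℕ∞) (deriv (deriv U)) := by
    have h1 : ContDiff ℝ (⊤ : ℕ∞) (deriv U) := (contDiff_infty_iff_deriv.1 hUs).2
    exact (contDiff_infty_iff_deriv.1 h1).2
  have hU2b : ∀ k y, 0 ≤ y →
      ‖iteratedDeriv k (fun y => ((deriv (deriv U) y : ℝ) : ℂ)) y‖ ≤
        Cd (k + 2) * Real.exp (-η₀ * y) := by
    intro k y hy
    rw [aux_ofReal _ hU2, Complex.norm_real, Real.norm_eq_abs, ← iteratedDeriv_succ',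
      ← iteratedDeriv_succ']
    exact hCd (k + 2) (by omega) y hy
  set G : ℕ → ℝ := fun j =>
    ∑ i ∈ Finset.range (j + 1), (j.choose i : ℝ) * Cd (i + 2) * 1 with hG
  have hG0 : ∀ j, 0 ≤ G j := fun j => Finset.sum_nonneg fun i _ => by
    have := hCd0 (i + 2) (by omega); positivity
  choose D hD0 hD using Itil_bound α η₀ hα hη G hG0
  set Ej : ℕ → ℝ := fun j =>
    ∑ i ∈ Finset.range (j + 1), (j.choose i : ℝ) * FK i * D (j - i) with hEj
  have hEj0 : ∀ j, 0 ≤ Ej j := fun j => Finset.sum_nonneg fun i _ => by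
    have := hFK0 i; have := hD0 (j - i); positivity
  have hE1 : 0 ≤ (2 * α * δ)⁻¹ * D 0 := by have := hD0 0; positivity
  refine ⟨(∑ j ∈ Finset.range (n + 1), Ej j) + (2 * α * δ)⁻¹ * D 0,
    add_nonneg (Finset.sum_nonneg fun j _ => hEj0 j) hE1, ?_⟩
  intro a ha s hs φ hφ M hM hb
  set g : ℝ → ℂ := fun x => ((deriv (deriv U) x : ℝ) : ℂ) * φ x with hgdef
  have hg : ContDiff ℝ n g := (aux_ofReal_smooth _ hU2 n).mul hφ
  have hgb : ∀ i ≤ n, ∀ y, a ≤ y →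
        ‖iteratedDeriv i g y‖ ≤ G i * M * (Real.exp (-η₀ * y) * Real.exp (-s * y)) := by
    intro i hi y hy
    have hφi : ContDiff ℝ i φ := hφ.of_le (by exact_mod_cast hi)
    have := aux_prod_bound (fun x => ((deriv (deriv U) x : ℝ) : ℂ)) φ i y
      (aux_ofReal_smooth _ hU2 i).contDiffAt hφi.contDiffAt (fun i => Cd (i + 2)) (fun _ => 1)
      (Real.exp (-η₀ * y)) (M * Real.exp (-s * y)) (fun i => (hCd0 _ (by omega)).le)
      (Real.exp_pos _).le (fun k _ => hU2b k y (by linarith))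
      (fun k hk => by rw [one_mul]; exact hb k (by omega) y hy)
    refine this.trans (le_of_eq ?_)
    simp only [hG]
    ring
  have hg0 := hgb 0 (by omega)
  simp only [iteratedDeriv_zero] at hg0
  have hT : ∀ y, a ≤ y → Talpha U α a c φ y = (V y)⁻¹ * Itil α a g y := by
    intro y hy
    rw [← Itil_eq α a η₀ s (G 0 * M) hη (mul_nonneg (hG0 0) hM) hs g hg.continuous y hy hg0]
    simp only [Talpha, hVdef, hgdef, mul_assoc]
  have hIs : ∀ j ≤ n, ContDiff ℝ j (Itil α a g) := fun j hj => Itil_smooth α a g n hg j hj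
  set X : ℝ → ℝ := fun y => M * (Real.exp (-η₀ * a) * Real.exp (-s * y)) with hX
  have hX0 : ∀ y, 0 ≤ X y := fun y => by positivity
  refine ⟨?_, ?_, ?_⟩
  · have : ContDiffOn ℝ n (fun y => (V y)⁻¹ * Itil α a g y) (Ioi a) := by
      intro y hy
      have hy : a < y := hy
      exact (((hVs n).contDiffAt.inv (hVne y (by linarith))).mul
        (hIs n le_rfl).contDiffAt).contDiffWithinAt
    exact this.congr fun y hy => hT y (le_of_lt hy)
  · intro y hy
    rw [hT y hy, norm_mul, norm_inv]
    have h1 := hD 0 a s M n g hs hM (by omega) hg hgb y hy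
    rw [iteratedDeriv_zero] at h1
    have h2 : ‖V y‖⁻¹ ≤ (2 * α * δ)⁻¹ := inv_anti₀ (by positivity) (hVδ y (by linarith))
    calc ‖V y‖⁻¹ * ‖Itil α a g y‖ ≤ (2 * α * δ)⁻¹ * (D 0 * X y) := by gcongr
      _ = ((2 * α * δ)⁻¹ * D 0) * X y := by ring
      _ ≤ _ := mul_le_mul_of_nonneg_right
        (le_add_of_nonneg_left (Finset.sum_nonneg fun j _ => hEj0 j)) (hX0 y)
  · intro j hj y hy
    have e : Talpha U α a c φ =ᶠ[𝓝 y] fun y => (V y)⁻¹ * Itil α a g y := by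
      filter_upwards [Ioi_mem_nhds hy] with z hz using hT z (le_of_lt hz)
    rw [e.iteratedDeriv_eq j]
    have := aux_prod_bound (fun y => (V y)⁻¹) (Itil α a g) j y
      ((hVs j).contDiffAt.inv (hVne y (by linarith))) (hIs j hj).contDiffAt FK D 1 (X y) hFK0
      zero_le_one (fun i _ => by rw [mul_one]; exact hFK i y (by linarith))
      (fun i hi => hD i a s M n g hs hM (by omega) hg hgb y hy.le)
    rw [one_mul] at this
    refine this.trans (mul_le_mul_of_nonneg_right ?_ (hX0 y))
    have h5 : Ej j ≤ ∑ j ∈ Finset.range (n + 1), Ej j :=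
      Finset.single_le_sum (f := Ej) (fun i _ => hEj0 i) (Finset.mem_range.2 (by omega))
    exact le_add_of_le_of_nonneg h5 hE1

lemma aux_main (U : ℝ → ℝ) (η₀ : ℝ) (hU : ShearFlow U η₀) (c : ℂ)
    (hc : ∃ δ : ℝ, 0 < δ ∧ ∀ y : ℝ, 0 ≤ y → δ ≤ ‖(U y : ℂ) - c‖)
    (α : ℝ) (hα : 0 < α) (n : ℕ) :
    ∃ yn : ℝ, 0 ≤ yn ∧ ∀ a : ℝ, yn ≤ a → ∀ s : ℝ, |s| ≤ α → ∀ φ : ℝ → ℂ, ContDiff ℝ n φ →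
      ∀ M : ℝ, (∀ j ≤ n, ∀ y : ℝ, a ≤ y → Real.exp (s * y) * ‖iteratedDeriv j φ y‖ ≤ M) →
      ∀ j ≤ n, ∀ y : ℝ, a ≤ y →
        Real.exp (s * y) * ‖iteratedDeriv j (Talpha U α a c φ) y‖ ≤ (1 / 2) * M := by
  obtain ⟨E, hE, h⟩ := aux_core U η₀ hU c hc α hα n
  have hη : 0 < η₀ := hU.2.2.2.2.2.2.1
  refine ⟨2 * E / η₀, by positivity, ?_⟩
  intro a ha s hs φ hφ M hb
  have ha0 : 0 ≤ a := le_trans (by positivity) ha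
  have hM : 0 ≤ M := le_trans (by positivity) (hb 0 (by omega) a le_rfl)
  have hb' : ∀ j ≤ n, ∀ y : ℝ, a ≤ y → ‖iteratedDeriv j φ y‖ ≤ M * Real.exp (-s * y) := by
    intro j hj y hy
    rw [neg_mul, Real.exp_neg, ← div_eq_mul_inv, le_div_iff₀ (Real.exp_pos _), mul_comm]
    exact hb j hj y hy
  have hsmall : E * Real.exp (-η₀ * a) ≤ 1 / 2 := by
    have h1 : 2 * E ≤ η₀ * a := by rw [div_le_iff₀ hη] at ha; linarith
    have h2 := Real.add_one_le_exp (η₀ * a)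
    rw [neg_mul, Real.exp_neg, ← div_eq_mul_inv, div_le_iff₀ (Real.exp_pos _)]
    linarith
  obtain ⟨hsm, h0, hj'⟩ := h a ha0 s hs φ hφ M hM hb'
  set W : ℝ → ℝ := fun y => 1 / 2 * M * Real.exp (-s * y) with hW
  have hEW : ∀ y, E * (M * (Real.exp (-η₀ * a) * Real.exp (-s * y))) ≤ W y := by
    intro y
    calc _ = (E * Real.exp (-η₀ * a)) * (M * Real.exp (-s * y)) := by ring
      _ ≤ 1 / 2 * (M * Real.exp (-s * y)) := by gcongr
      _ = W y := by rw [hW]; ring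
  have key : ∀ j ≤ n, ∀ y : ℝ, a ≤ y → ‖iteratedDeriv j (Talpha U α a c φ) y‖ ≤ W y := by
    intro j hj y hy
    rcases hy.lt_or_eq with hy | rfl
    · exact (hj' j hj y hy).trans (hEW y)
    · cases j with
      | zero => rw [iteratedDeriv_zero]; exact (h0 a le_rfl).trans (hEW a)
      | succ j =>
        rw [iteratedDeriv_succ]
        refine aux_endpoint _ W a (by fun_prop) (by positivity) (fun z hz => ?_) (fun z hz => ?_)
        · have h1 := hsm.differentiableOn_iteratedDerivWithin (m := j)
            (by exact_mod_cast (by omega : j < n)) isOpen_Ioi.uniqueDiffOn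
          have h2 := h1.congr fun x hx => ((iteratedDerivWithin_of_isOpen isOpen_Ioi) hx).symm
          exact h2.differentiableAt (Ioi_mem_nhds hz)
        · rw [← iteratedDeriv_succ]
          exact (hj' (j + 1) hj z hz).trans (hEW z)
  intro j hj y hy
  have := key j hj y hy
  rw [hW] at this
  simp only [neg_mul, Real.exp_neg, ← div_eq_mul_inv] at this
  rw [le_div_iff₀ (Real.exp_pos _)] at this
  linarith

/-- for every `n` there are `yₙ ≥ 0` and `λ ∈ (0,1)` such that for `ȳ ≥ yₙ`
the operator `T_{α;ȳ}` is a contraction on both `W^∞_{n,α;ȳ}` and `W^∞_{n,−α;ȳ}`. -/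
theorem stmt_5 (U : ℝ → ℝ) (η₀ : ℝ) (hU : ShearFlow U η₀) (c : ℂ)
    (hc : ∃ δ : ℝ, 0 < δ ∧ ∀ y : ℝ, 0 ≤ y → δ ≤ ‖(U y : ℂ) - c‖)
    (α : ℝ) (hα : 0 < α) :
    ∀ n : ℕ, ∃ yn : ℝ, 0 ≤ yn ∧ ∃ lam : ℝ, 0 < lam ∧ lam < 1 ∧
      ∀ ybar : ℝ, yn ≤ ybar → ∀ φ : ℝ → ℂ, ContDiff ℝ (n : ℕ∞) φ → ∀ M : ℝ,
        ((∀ j ≤ n, ∀ y : ℝ, ybar ≤ y →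
            Real.exp (α * y) * ‖iteratedDeriv j φ y‖ ≤ M) →
          ∀ j ≤ n, ∀ y : ℝ, ybar ≤ y →
            Real.exp (α * y) * ‖iteratedDeriv j (Talpha U α ybar c φ) y‖ ≤
              lam * M) ∧
        ((∀ j ≤ n, ∀ y : ℝ, ybar ≤ y →
            Real.exp (-(α * y)) * ‖iteratedDeriv j φ y‖ ≤ M) →
          ∀ j ≤ n, ∀ y : ℝ, ybar ≤ y →
            Real.exp (-(α * y)) * ‖iteratedDeriv j (Talpha U α ybar c φ) y‖ ≤
              lam * M) := by
  intro n
  obtain ⟨yn, hyn, h⟩ := aux_main U η₀ hU c hc α hα n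
  refine ⟨yn, hyn, 1 / 2, by norm_num, by norm_num, ?_⟩
  intro ybar hy φ hφ M
  have hφ' : ContDiff ℝ n φ := by exact_mod_cast hφ
  refine ⟨fun hb => h ybar hy α (abs_of_pos hα).le φ hφ' M hb, fun hb => ?_⟩
  simp only [← neg_mul] at hb ⊢
  exact h ybar hy (-α) (by rw [abs_neg, abs_of_pos hα]) φ hφ' M hb
end
end

section
/- Let U_s be a shear flow, α ∈ ℝ, c ∈ ℂ with inf_{y≥0}|U_s(y) − c| > 0, let y₀ > 0, k ∈ ℕ, ψ ∈ C^k([0,y₀];ℂ), and a, b ∈ ℂ. Then the unique solution φ : [0,y₀] → ℂ of the initial value problem Ray*_c φ = ψ on [0,y₀], φ(0) = a, φ'(0) = b, satisfies sup_{[0,y₀]}|φ^{(k)}| ≤ C_k·( max_{0 ≤ j ≤ max(k−2,0)} sup_{[0,y₀]}|ψ^{(j)}| + |a| + |b| ), where C_k > 0 depends only on U_s, α, c, y₀ and k. -/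
open MeasureTheory Filter Set

noncomputable section

lemma aux_mul_bound (S : Set ℝ) (hS : IsCompact S) (hu : UniqueDiffOn ℝ S) (n : ℕ) (g : ℝ → ℂ)
    (hg : ContDiffOn ℝ n g S) :
    ∃ K : ℝ, 0 ≤ K ∧ ∀ (f : ℝ → ℂ) (N : ℝ), ContDiffOn ℝ n f S →
      (∀ j ≤ n, ∀ x ∈ S, ‖iteratedDerivWithin j f S x‖ ≤ N) →
      ∀ x ∈ S, ‖iteratedDerivWithin n (fun y => g y * f y) S x‖ ≤ K * N := by
  have hb : ∀ j : ℕ, ∃ B : ℝ, 0 ≤ B ∧ (j ≤ n → ∀ x ∈ S, ‖iteratedDerivWithin j g S x‖ ≤ B) := by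
    intro j
    by_cases hj : j ≤ n
    · have hcont : ContinuousOn (iteratedDerivWithin j g S) S :=
        hg.continuousOn_iteratedDerivWithin (by exact_mod_cast hj) hu
      obtain ⟨B, hB⟩ := hS.exists_bound_of_continuousOn hcont
      exact ⟨max B 0, le_max_right _ _, fun _ x hx => (hB x hx).trans (le_max_left _ _)⟩
    · exact ⟨0, le_rfl, fun h => absurd h hj⟩
  choose B hB0 hB using hb
  refine ⟨∑ i ∈ Finset.range (n + 1), (n.choose i : ℝ) * B i,
    Finset.sum_nonneg fun i _ => mul_nonneg (Nat.cast_nonneg _) (hB0 i), ?_⟩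
  intro f N hf hN x hx
  have h := norm_iteratedFDerivWithin_mul_le hg hf hu hx (n := n) le_rfl
  simp only [norm_iteratedFDerivWithin_eq_norm_iteratedDerivWithin] at h
  refine h.trans ?_
  rw [Finset.sum_mul]
  refine Finset.sum_le_sum fun i hi => ?_
  have hi' : i ≤ n := Nat.lt_succ_iff.mp (Finset.mem_range.mp hi)
  exact mul_le_mul (mul_le_mul_of_nonneg_left (hB i hi' x hx) (Nat.cast_nonneg _))
    (hN _ (Nat.sub_le _ _) x hx) (norm_nonneg _) (mul_nonneg (Nat.cast_nonneg _) (hB0 i))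

/-- Gronwall step. -/
lemma aux_gronwall (y₀ : ℝ) (hy₀ : 0 < y₀) (A KB KG : ℝ) (hA : 0 ≤ A) (hKB : 0 ≤ KB)
    (hKG : 0 ≤ KG) :
    ∃ C : ℝ, 0 < C ∧ ∀ (φ : ℝ → ℂ) (M : ℝ), ContDiff ℝ 2 φ → 0 ≤ M →
      (∀ y ∈ Set.Icc (0 : ℝ) y₀,
        ‖deriv (deriv φ) y‖ ≤ A * ‖φ y‖ + KB * ‖deriv φ y‖ + KG * M) →
      ∀ y ∈ Set.Icc (0 : ℝ) y₀, ‖φ y‖ ≤ C * (M + ‖φ 0‖ + ‖deriv φ 0‖) ∧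
        ‖deriv φ y‖ ≤ C * (M + ‖φ 0‖ + ‖deriv φ 0‖) := by
  set K := 1 + A + KB with hK
  have hK1 : 1 ≤ K := by linarith
  refine ⟨Real.exp (K * y₀) * (1 + KG), by positivity, ?_⟩
  intro φ M hφ hM hb y hy
  have hφ' : ContDiff ℝ 1 (deriv φ) := by
    have : ContDiff ℝ (1 + 1) φ := by norm_num; exact hφ
    exact (contDiff_succ_iff_deriv.mp this).2.2
  have hd : ∀ x, HasDerivAt φ (deriv φ x) x := fun x =>
    (hφ.differentiable (by norm_num) x).hasDerivAt
  have hd' : ∀ x, HasDerivAt (deriv φ) (deriv (deriv φ) x) x := fun x =>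
    (hφ'.differentiable (by norm_num) x).hasDerivAt
  have key := norm_le_gronwallBound_of_norm_deriv_right_le
    (f := fun x => (φ x, deriv φ x)) (f' := fun x => (deriv φ x, deriv (deriv φ) x))
    (δ := ‖φ 0‖ + ‖deriv φ 0‖) (K := K) (ε := KG * M) (a := 0) (b := y₀)
    (hφ.continuous.prodMk hφ'.continuous).continuousOn
    (fun x _ => ((hd x).prodMk (hd' x)).hasDerivWithinAt)
    (by
      rw [Prod.norm_def]
      exact max_le (by simp) (by simp)) 
    (by
      intro x hx
      have h1 := hb x ⟨hx.1, hx.2.le⟩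
      have h2 : ‖φ x‖ ≤ ‖(φ x, deriv φ x)‖ := norm_fst_le (φ x, deriv φ x)
      have h3 : ‖deriv φ x‖ ≤ ‖(φ x, deriv φ x)‖ := norm_snd_le (φ x, deriv φ x)
      set z := ‖(φ x, deriv φ x)‖
      have hz : 0 ≤ z := norm_nonneg _
      have h4 := mul_le_mul_of_nonneg_left h2 hA
      have h5 := mul_le_mul_of_nonneg_left h3 hKB
      have h6 := mul_nonneg hA hz
      have h7 := mul_nonneg hKB hz
      have h8 := mul_nonneg hKG hM
      rw [Prod.norm_def]
      refine max_le ?_ ?_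
      · simp only [hK]; nlinarith
      · simp only [hK]; nlinarith) y hy
  rw [gronwallBound_of_K_ne_0 (by linarith)] at key
  have hE : Real.exp (K * (y - 0)) ≤ Real.exp (K * y₀) := by
    apply Real.exp_le_exp.mpr
    have := hy.2
    rw [sub_zero]; gcongr
  set E := Real.exp (K * y₀)
  have hE0 : 0 < E := Real.exp_pos _
  have hs : 0 ≤ ‖φ 0‖ + ‖deriv φ 0‖ := by positivity
  have hKM : 0 ≤ KG * M := mul_nonneg hKG hM
  have hq : KG * M / K ≤ KG * M := div_le_self hKM hK1
  have hq0 : 0 ≤ KG * M / K := by positivity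
  have key2 : ‖(φ y, deriv φ y)‖ ≤ E * (1 + KG) * (M + ‖φ 0‖ + ‖deriv φ 0‖) := by
    refine key.trans ?_
    have e1 : (‖φ 0‖ + ‖deriv φ 0‖) * Real.exp (K * (y - 0)) ≤ (‖φ 0‖ + ‖deriv φ 0‖) * E :=
      mul_le_mul_of_nonneg_left hE hs
    have e2 : KG * M / K * (Real.exp (K * (y - 0)) - 1) ≤ KG * M * E := by
      calc _ ≤ KG * M / K * E := mul_le_mul_of_nonneg_left (by linarith) hq0
        _ ≤ _ := mul_le_mul_of_nonneg_right hq hE0.le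
    have e3 : 0 ≤ E * M := by positivity
    have e4 : 0 ≤ E * KG * (‖φ 0‖ + ‖deriv φ 0‖) := by positivity
    nlinarith
  exact ⟨(norm_fst_le (φ y, deriv φ y)).trans key2, (norm_snd_le (φ y, deriv φ y)).trans key2⟩

/-- The abstract estimate for `φ'' = A φ + B φ' + G ψ`. -/
lemma aux_main_s13 (y₀ : ℝ) (hy₀ : 0 < y₀) (A : ℂ) (B G : ℝ → ℂ)
    (hB : ∀ n : ℕ, ContDiffOn ℝ n B (Set.Icc 0 y₀))
    (hG : ∀ n : ℕ, ContDiffOn ℝ n G (Set.Icc 0 y₀)) (n : ℕ) :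
    ∃ C : ℝ, 0 < C ∧
      ∀ (ψ φ : ℝ → ℂ) (M : ℝ),
        ContDiffOn ℝ n ψ (Set.Icc 0 y₀) →
        ContDiff ℝ (n + 2 : ℕ) φ →
        (∀ y ∈ Set.Icc (0 : ℝ) y₀, deriv (deriv φ) y = A * φ y + B y * deriv φ y + G y * ψ y) →
        (∀ j ≤ n - 1, ∀ x ∈ Set.Icc (0 : ℝ) y₀,
          ‖iteratedDerivWithin j ψ (Set.Icc 0 y₀) x‖ ≤ M) →
        ∀ m ≤ n + 1, ∀ y ∈ Set.Icc (0 : ℝ) y₀,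
          ‖iteratedDeriv m φ y‖ ≤ C * (M + ‖φ 0‖ + ‖deriv φ 0‖) := by
  have hu : UniqueDiffOn ℝ (Set.Icc (0 : ℝ) y₀) := uniqueDiffOn_Icc hy₀
  have h0 : (0 : ℝ) ∈ Set.Icc (0 : ℝ) y₀ := ⟨le_rfl, hy₀.le⟩
  induction n with
  | zero =>
    obtain ⟨KB, hKB⟩ := isCompact_Icc.exists_bound_of_continuousOn (hB 0).continuousOn
    obtain ⟨KG, hKG⟩ := isCompact_Icc.exists_bound_of_continuousOn (hG 0).continuousOn
    have hKB0 : 0 ≤ KB := (norm_nonneg _).trans (hKB 0 h0)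
    have hKG0 : 0 ≤ KG := (norm_nonneg _).trans (hKG 0 h0)
    obtain ⟨C, hC, H⟩ := aux_gronwall y₀ hy₀ ‖A‖ KB KG (norm_nonneg _) hKB0 hKG0
    refine ⟨C, hC, ?_⟩
    intro ψ φ M hψ hφ heq hM m hm y hy
    have hM' : ∀ x ∈ Set.Icc (0 : ℝ) y₀, ‖ψ x‖ ≤ M := by
      intro x hx
      simpa using hM 0 (by simp) x hx
    have := H φ M (by simpa using hφ) ((norm_nonneg _).trans (hM' 0 h0)) (by
      intro x hx
      rw [heq x hx]
      refine (norm_add₃_le).trans ?_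
      rw [norm_mul, norm_mul, norm_mul]
      have a1 := mul_le_mul_of_nonneg_right (hKB x hx) (norm_nonneg (deriv φ x))
      have a2 := mul_le_mul (hKG x hx) (hM' x hx) (norm_nonneg _) hKG0
      linarith) y hy
    interval_cases m
    · simpa using this.1
    · simpa using this.2
  | succ n ih =>
    obtain ⟨C, hC, H⟩ := ih
    obtain ⟨K1, hK1, H1⟩ := aux_mul_bound _ isCompact_Icc hu n (fun _ => A) contDiffOn_const
    obtain ⟨K2, hK2, H2⟩ := aux_mul_bound _ isCompact_Icc hu n B (hB n)
    obtain ⟨K3, hK3, H3⟩ := aux_mul_bound _ isCompact_Icc hu n G (hG n)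
    refine ⟨C + (K1 * C + K2 * C + K3), by positivity, ?_⟩
    intro ψ φ M hψ hφ heq hM m hm y hy
    have hψn : ContDiffOn ℝ n ψ (Set.Icc 0 y₀) := hψ.of_le (by exact_mod_cast Nat.le_succ n)
    have hφn : ContDiff ℝ (n + 2 : ℕ) φ := hφ.of_le (by exact_mod_cast (by omega))
    have hφ1 : ContDiff ℝ (n + 1 : ℕ) (deriv φ) := by
      have : ContDiff ℝ ((n + 1 : ℕ) + 1) φ := by exact_mod_cast hφn
      exact (contDiff_succ_iff_deriv.mp this).2.2
    have hφ2 : ContDiff ℝ n (deriv (deriv φ)) := by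
      have : ContDiff ℝ ((n : ℕ) + 1) (deriv φ) := by exact_mod_cast hφ1
      exact (contDiff_succ_iff_deriv.mp this).2.2
    have hφ0 : ContDiff ℝ n φ := hφn.of_le (by exact_mod_cast (by omega))
    have hφ1n : ContDiff ℝ n (deriv φ) := hφ1.of_le (by exact_mod_cast (by omega))
    have IH := H ψ φ M hψn hφn heq (fun j hj => hM j (by omega))
    set T := M + ‖φ 0‖ + ‖deriv φ 0‖ with hT
    have hM0 : 0 ≤ M := (norm_nonneg _).trans (hM 0 (by omega) 0 h0)
    have hMT : M ≤ T := by
      have := norm_nonneg (φ 0); have := norm_nonneg (deriv φ 0); linarith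
    have hT0 : 0 ≤ T := hM0.trans hMT
    have hX : 0 ≤ (K1 * C + K2 * C + K3) * T := by positivity
    by_cases hm' : m ≤ n + 1
    · have := IH m hm' y hy
      linarith
    · have hmn : m = n + 2 := by omega
      subst hmn
      have hW : ∀ (f : ℝ → ℂ) (j : ℕ) (x : ℝ), ContDiff ℝ j f → x ∈ Set.Icc (0 : ℝ) y₀ →
          iteratedDerivWithin j f (Set.Icc 0 y₀) x = iteratedDeriv j f x := fun f j x hf hx =>
        iteratedDerivWithin_eq_iteratedDeriv hu hf.contDiffAt hx
      have e1 := H1 φ (C * T) hφ0.contDiffOn (fun j hj x hx => by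
        rw [hW φ j x (hφ0.of_le (by exact_mod_cast hj)) hx]
        exact IH j (by omega) x hx) y hy
      have e2 := H2 (deriv φ) (C * T) hφ1n.contDiffOn (fun j hj x hx => by
        rw [hW _ j x (hφ1n.of_le (by exact_mod_cast hj)) hx, ← iteratedDeriv_succ']
        exact IH (j + 1) (by omega) x hx) y hy
      have e3 := H3 ψ M hψn (fun j hj x hx => hM j (by omega) x hx) y hy
      have c1 : ContDiffOn ℝ n (fun y => A * φ y) (Set.Icc 0 y₀) :=
        contDiffOn_const.mul hφ0.contDiffOn
      have c2 : ContDiffOn ℝ n (fun y => B y * deriv φ y) (Set.Icc 0 y₀) :=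
        (hB n).mul hφ1n.contDiffOn
      have c3 : ContDiffOn ℝ n (fun y => G y * ψ y) (Set.Icc 0 y₀) := (hG n).mul hψn
      have hmain : iteratedDeriv (n + 2) φ y =
          iteratedDerivWithin n (fun y => A * φ y) (Set.Icc 0 y₀) y
          + iteratedDerivWithin n (fun y => B y * deriv φ y) (Set.Icc 0 y₀) y
          + iteratedDerivWithin n (fun y => G y * ψ y) (Set.Icc 0 y₀) y := by
        rw [iteratedDeriv_succ', iteratedDeriv_succ', ← hW _ n y hφ2 hy]
        rw [iteratedDerivWithin_congr (g := ((fun y => A * φ y) + fun y => B y * deriv φ y)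
          + fun y => G y * ψ y) (fun x hx => heq x hx) hy]
        rw [iteratedDerivWithin_add hy hu (f := (fun y => A * φ y) + fun y => B y * deriv φ y)
          ((c1.add c2) y hy) (c3 y hy),
          iteratedDerivWithin_add hy hu (c1 y hy) (c2 y hy)]
      rw [hmain]
      refine norm_add₃_le.trans ?_
      have e4 : K3 * M ≤ K3 * T := mul_le_mul_of_nonneg_left hMT hK3
      have e5 : 0 ≤ C * T := by positivity
      nlinarith

/-- a priori estimate for the initial value problem
`Ray*_c φ = ψ` on `[0,y₀]`, `φ(0) = a`, `φ'(0) = b`: the `k`-th derivative of the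
solution is controlled by the first `max(k−2,0)` derivatives of `ψ` and `|a| + |b|`,
with a constant depending only on `U`, `α`, `c`, `y₀` and `k`. -/
theorem stmt_13 (U : ℝ → ℝ) (η₀ : ℝ) (hU : ShearFlow U η₀) (α : ℝ) (c : ℂ)
    (hc : ∃ δ : ℝ, 0 < δ ∧ ∀ y : ℝ, 0 ≤ y → δ ≤ ‖(U y : ℂ) - c‖)
    (y₀ : ℝ) (hy₀ : 0 < y₀) (k : ℕ) :
    ∃ C : ℝ, 0 < C ∧
      ∀ (ψ φ : ℝ → ℂ) (a b : ℂ) (M : ℝ),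
        ContDiffOn ℝ (k : ℕ∞) ψ (Set.Icc 0 y₀) →
        ContDiff ℝ ((k + 2 : ℕ) : ℕ∞) φ →
        (∀ y ∈ Set.Icc (0 : ℝ) y₀, RayStar U α c φ y = ψ y) →
        φ 0 = a → deriv φ 0 = b →
        (∀ j ≤ k - 2, ∀ x ∈ Set.Icc (0 : ℝ) y₀,
          ‖iteratedDerivWithin j ψ (Set.Icc 0 y₀) x‖ ≤ M) →
        ∀ y ∈ Set.Icc (0 : ℝ) y₀,
          ‖iteratedDeriv k φ y‖ ≤ C * (M + ‖a‖ + ‖b‖) := by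
  obtain ⟨hUs, -⟩ := hU
  obtain ⟨δ, hδ, hc⟩ := hc
  have hne : ∀ y ∈ Set.Icc (0 : ℝ) y₀, (U y : ℂ) - (starRingEnd ℂ) c ≠ 0 := by
    intro y hy h
    have h1 := hc y hy.1
    have h2 : (starRingEnd ℂ) ((U y : ℂ) - c) = 0 := by
      rw [map_sub, Complex.conj_ofReal]; exact h
    have h3 : (U y : ℂ) - c = 0 := (map_eq_zero (starRingEnd ℂ)).mp h2
    rw [h3, norm_zero] at h1
    linarith
  have hUn : ∀ n : ℕ, ContDiff ℝ n U := fun n => hUs.of_le (by exact_mod_cast le_top)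
  have hU'n : ∀ n : ℕ, ContDiff ℝ n (deriv U) := fun n => by
    have : ContDiff ℝ ((n : ℕ) + 1) U := by exact_mod_cast hUn (n + 1)
    exact (contDiff_succ_iff_deriv.mp this).2.2
  have hG : ∀ n : ℕ, ContDiffOn ℝ n (fun y => ((U y : ℂ) - (starRingEnd ℂ) c)⁻¹)
      (Set.Icc 0 y₀) := fun n =>
    (((Complex.ofRealCLM.contDiff.comp (hUn n)).sub contDiff_const).contDiffOn).inv hne
  have hB : ∀ n : ℕ, ContDiffOn ℝ n (fun y => (-2 * ((deriv U y : ℝ) : ℂ)) *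
      ((U y : ℂ) - (starRingEnd ℂ) c)⁻¹) (Set.Icc 0 y₀) := fun n =>
    ((contDiff_const.mul (Complex.ofRealCLM.contDiff.comp (hU'n n))).contDiffOn).mul (hG n)
  obtain ⟨C, hC, H⟩ := aux_main_s13 y₀ hy₀ ((α : ℂ) ^ 2) _ _ hB hG (k - 1)
  refine ⟨C, hC, ?_⟩
  intro ψ φ a b M hψ hφ heq ha hb hM y hy
  subst ha hb
  refine H ψ φ M (hψ.of_le (WithTop.coe_le_coe.mpr (Nat.cast_le.mpr (Nat.sub_le k 1))))
    (hφ.of_le (WithTop.coe_le_coe.mpr (Nat.cast_le.mpr (by omega)))) ?_ (fun j hj => hM j (by omega)) k (by omega) y hy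
  intro x hx
  have h := heq x hx
  have hx0 := hne x hx
  simp only [RayStar, DeltaA] at h
  rw [← h]
  field_simp
  ring
end
end

section
/- Let U_s be a shear flow, α > 0, c ∈ ℂ with inf_{y≥0}|U_s(y) − c| > 0, and let φ^{*,±} be smooth solutions of Ray*_c φ = 0 with (φ^{*,±})^{(n)}(y) asymptotic to nonzero multiples of e^{±αy} as y → ∞ for every n. For every N ∈ ℕ there exist smooth functions ψ^{k,±} : [0,∞) → ℂ (1 ≤ k ≤ N), independent of ν, and constants D_N > 0 and (C_j)_{j∈ℕ}, such that: (i) for every j, k one has sup_{y≥0} e^{∓αy}|(ψ^{k,±})^{(j)}(y)| ≤ C_j with C_j independent of k; and (ii) for all sufficiently small ν > 0, the functions φ^{s,±}_N := φ^{*,±} + Σ_{k=1}^N ν^k ψ^{k,±} satisfy |Orr*_{c,ν} φ^{s,±}_N(y)| ≤ D_N ν^{N+1} e^{±αy} for all y ≥ 0. -/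
open MeasureTheory Filter Set

noncomputable section

/-- The adjoint Orr-Sommerfeld operator
`Orr*_{c,ν} φ = (U − conj c) Δ_α φ + 2 U' φ' + (ν/(iα)) Δ_α² φ`. -/
def OrrStar (U : ℝ → ℝ) (α ν : ℝ) (c : ℂ) (φ : ℝ → ℂ) : ℝ → ℂ :=
  fun y => RayStar U α c φ y + ((ν : ℂ) / (Complex.I * (α : ℂ))) * DeltaA α (DeltaA α φ) y

/-- The Orr-Sommerfeld operator
`Orr_{c,ν} φ = (U − c) Δ_α φ − U'' φ − (ν/(iα)) Δ_α² φ`. -/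
def Orr (U : ℝ → ℝ) (α ν : ℝ) (c : ℂ) (φ : ℝ → ℂ) : ℝ → ℂ :=
  fun y => Ray U α c φ y - ((ν : ℂ) / (Complex.I * (α : ℂ))) * DeltaA α (DeltaA α φ) y



/-- exponential bound on `[0,∞)` -/
def EB0 (s : ℝ) (f : ℝ → ℂ) : Prop := ∃ C : ℝ, ∀ y : ℝ, 0 ≤ y → ‖f y‖ ≤ C * Real.exp (s * y)

/-- exponential bound on `[0,∞)` of the derivatives up to order `n` -/
def EB (s : ℝ) : ℕ → (ℝ → ℂ) → Prop
  | 0, f => EB0 s f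
  | n + 1, f => EB0 s f ∧ EB s n (deriv f)

/-- smooth functions all of whose derivatives are `O(e^{sy})` on `[0,∞)` -/
def CE (s : ℝ) (f : ℝ → ℂ) : Prop := ContDiff ℝ (⊤ : ℕ∞) f ∧ ∀ n, EB s n f

lemma smooth_deriv {f : ℝ → ℂ} (hf : ContDiff ℝ (⊤ : ℕ∞) f) : ContDiff ℝ (⊤ : ℕ∞) (deriv f) :=
  (contDiff_infty_iff_deriv.1 hf).2

lemma smooth_diff {f : ℝ → ℂ} (hf : ContDiff ℝ (⊤ : ℕ∞) f) : Differentiable ℝ f :=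
  (contDiff_infty_iff_deriv.1 hf).1

lemma EB.zero {s : ℝ} {n : ℕ} {f : ℝ → ℂ} (h : EB s n f) : EB0 s f := by
  cases n with
  | zero => exact h
  | succ n => exact h.1

lemma EB.pred {s : ℝ} {n : ℕ} : ∀ {f : ℝ → ℂ}, EB s (n + 1) f → EB s n f := by
  induction n with
  | zero => intro f h; exact h.1
  | succ n ih => intro f h; exact ⟨h.1, ih h.2⟩

lemma EB0.add {s : ℝ} {f g : ℝ → ℂ} (hf : EB0 s f) (hg : EB0 s g) :
    EB0 s (fun y => f y + g y) := by
  obtain ⟨C, hC⟩ := hf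
  obtain ⟨D, hD⟩ := hg
  refine ⟨C + D, fun y hy => (norm_add_le _ _).trans ?_⟩
  have := hC y hy
  have := hD y hy
  linarith

lemma EB0.mul {s t : ℝ} {f g : ℝ → ℂ} (hf : EB0 s f) (hg : EB0 t g) :
    EB0 (s + t) (fun y => f y * g y) := by
  obtain ⟨C, hC⟩ := hf
  obtain ⟨D, hD⟩ := hg
  refine ⟨C * D, fun y hy => ?_⟩
  have h1 := hC y hy
  have h2 := hD y hy
  rw [norm_mul, add_mul, Real.exp_add]
  calc ‖f y‖ * ‖g y‖ ≤ (C * Real.exp (s * y)) * (D * Real.exp (t * y)) :=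
        mul_le_mul h1 h2 (norm_nonneg _) ((norm_nonneg _).trans h1)
    _ = _ := by ring

lemma EB.add {s : ℝ} {n : ℕ} : ∀ {f g : ℝ → ℂ}, ContDiff ℝ (⊤ : ℕ∞) f → ContDiff ℝ (⊤ : ℕ∞) g →
    EB s n f → EB s n g → EB s n (fun y => f y + g y) := by
  induction n with
  | zero => intro f g _ _ h1 h2; exact EB0.add h1 h2
  | succ n ih =>
    intro f g hf hg h1 h2
    refine ⟨EB0.add h1.1 h2.1, ?_⟩
    have : deriv (fun y => f y + g y) = fun y => deriv f y + deriv g y := by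
      funext y; exact deriv_fun_add (smooth_diff hf y) (smooth_diff hg y)
    rw [this]
    exact ih (smooth_deriv hf) (smooth_deriv hg) h1.2 h2.2

lemma EB.mul {s t : ℝ} {n : ℕ} : ∀ {f g : ℝ → ℂ}, ContDiff ℝ (⊤ : ℕ∞) f →
    ContDiff ℝ (⊤ : ℕ∞) g →
    EB s n f → EB t n g → EB (s + t) n (fun y => f y * g y) := by
  induction n with
  | zero => intro f g _ _ h1 h2; exact EB0.mul h1 h2
  | succ n ih =>
    intro f g hf hg h1 h2
    refine ⟨EB0.mul h1.1 h2.1, ?_⟩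
    have : deriv (fun y => f y * g y) = fun y => deriv f y * g y + f y * deriv g y := by
      funext y; exact deriv_fun_mul (smooth_diff hf y) (smooth_diff hg y)
    rw [this]
    exact EB.add ((smooth_deriv hf).mul hg) (hf.mul (smooth_deriv hg))
      (ih (smooth_deriv hf) hg h1.2 h2.pred) (ih hf (smooth_deriv hg) h1.pred h2.2)

lemma EB0.mono {s t : ℝ} (hst : s ≤ t) {f : ℝ → ℂ} (hf : EB0 s f) : EB0 t f := by
  obtain ⟨C, hC⟩ := hf
  refine ⟨C, fun y hy => (hC y hy).trans ?_⟩
  have h0 := (norm_nonneg _).trans (hC y hy)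
  have hC0 : 0 ≤ C := nonneg_of_mul_nonneg_left h0 (Real.exp_pos _)
  gcongr

lemma EB.mono {s t : ℝ} (hst : s ≤ t) {n : ℕ} : ∀ {f : ℝ → ℂ}, EB s n f → EB t n f := by
  induction n with
  | zero => intro f h; exact EB0.mono hst h
  | succ n ih => intro f h; exact ⟨EB0.mono hst h.1, ih h.2⟩

lemma CE.add {s : ℝ} {f g : ℝ → ℂ} (hf : CE s f) (hg : CE s g) : CE s (fun y => f y + g y) :=
  ⟨hf.1.add hg.1, fun n => EB.add hf.1 hg.1 (hf.2 n) (hg.2 n)⟩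

lemma CE.mul {s t : ℝ} {f g : ℝ → ℂ} (hf : CE s f) (hg : CE t g) :
    CE (s + t) (fun y => f y * g y) :=
  ⟨hf.1.mul hg.1, fun n => EB.mul hf.1 hg.1 (hf.2 n) (hg.2 n)⟩

lemma CE.mono {s t : ℝ} (hst : s ≤ t) {f : ℝ → ℂ} (hf : CE s f) : CE t f :=
  ⟨hf.1, fun n => (hf.2 n).mono hst⟩

lemma CE.deriv {s : ℝ} {f : ℝ → ℂ} (hf : CE s f) : CE s (deriv f) :=
  ⟨smooth_deriv hf.1, fun n => (hf.2 (n + 1)).2⟩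

lemma CE.const (a : ℂ) : CE 0 (fun _ => a) := by
  refine ⟨contDiff_const, fun n => ?_⟩
  induction n generalizing a with
  | zero => exact ⟨‖a‖, fun y _ => by simp⟩
  | succ n ih =>
    refine ⟨⟨‖a‖, fun y _ => by simp⟩, ?_⟩
    have : _root_.deriv (fun _ : ℝ => a) = fun _ => 0 := by funext y; simp
    rw [this]; exact ih 0

lemma CE.cmul {s : ℝ} {f : ℝ → ℂ} (a : ℂ) (hf : CE s f) : CE s (fun y => a * f y) := by
  have := (CE.const a).mul hf
  rwa [zero_add] at this

lemma CE.delta {s : ℝ} {f : ℝ → ℂ} (α : ℝ) (hf : CE s f) : CE s (DeltaA α f) := by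
  have := hf.deriv.deriv.add (hf.cmul (-(α : ℂ) ^ 2))
  convert this using 2
  unfold DeltaA; ring

lemma CE.of_deriv {s : ℝ} {f : ℝ → ℂ} (hd : Differentiable ℝ f) (h0 : EB0 s f)
    (h1 : CE s (_root_.deriv f)) : CE s f := by
  refine ⟨contDiff_infty_iff_deriv.2 ⟨hd, h1.1⟩, fun n => ?_⟩
  cases n with
  | zero => exact h0
  | succ n => exact ⟨h0, h1.2 n⟩

lemma EB_of_iter {s : ℝ} {n : ℕ} : ∀ {f : ℝ → ℂ}, (∀ k, EB0 s (iteratedDeriv k f)) → EB s n f := by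
  induction n with
  | zero =>
    intro f h
    have h0 := h 0
    rw [iteratedDeriv_zero] at h0
    exact h0
  | succ n ih =>
    intro f h
    refine ⟨by simpa using h 0, ih fun k => ?_⟩
    rw [← iteratedDeriv_succ']; exact h (k + 1)

lemma CE.iter {s : ℝ} {f : ℝ → ℂ} (hf : CE s f) (k : ℕ) : EB0 s (iteratedDeriv k f) := by
  induction k generalizing f with
  | zero => rw [iteratedDeriv_zero]; exact hf.2 0
  | succ k ih => rw [iteratedDeriv_succ']; exact ih hf.deriv

lemma eqOn_deriv {f g : ℝ → ℂ} (hf : Differentiable ℝ f) (hg : Differentiable ℝ g)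
    (h : ∀ y, 0 ≤ y → f y = g y) : ∀ y, 0 ≤ y → deriv f y = deriv g y := by
  intro y hy
  have hu : UniqueDiffWithinAt ℝ (Ici (0:ℝ)) y := uniqueDiffOn_Ici 0 y hy
  rw [← (hf y).derivWithin hu, ← (hg y).derivWithin hu]
  exact derivWithin_congr (fun z hz => h z hz) (h y hy)

lemma EB0.congr {s : ℝ} {f g : ℝ → ℂ} (h : ∀ y, 0 ≤ y → f y = g y) (hf : EB0 s f) : EB0 s g := by
  obtain ⟨C, hC⟩ := hf
  exact ⟨C, fun y hy => by rw [← h y hy]; exact hC y hy⟩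

/-- division -/
lemma CE_div {s δ : ℝ} (hδ : 0 < δ) {V : ℝ → ℂ} (hV : CE 0 V) (hVδ : ∀ y, 0 ≤ y → δ ≤ ‖V y‖) (n : ℕ) :
    ∀ {f h : ℝ → ℂ}, ContDiff ℝ (⊤ : ℕ∞) f → ContDiff ℝ (⊤ : ℕ∞) h → EB s n h →
      (∀ y, 0 ≤ y → V y * f y = h y) → EB s n f := by
  have key : ∀ {f h : ℝ → ℂ}, EB0 s h → (∀ y, 0 ≤ y → V y * f y = h y) → EB0 s f := by
    intro f h ⟨C, hC⟩ he
    refine ⟨δ⁻¹ * C, fun y hy => ?_⟩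
    have h1 := hC y hy
    rw [← he y hy, norm_mul] at h1
    have h2 : δ * ‖f y‖ ≤ C * Real.exp (s * y) :=
      (mul_le_mul_of_nonneg_right (hVδ y hy) (norm_nonneg _)).trans h1
    rw [mul_assoc, ← div_eq_inv_mul, le_div_iff₀ hδ, mul_comm]; exact h2
  induction n with
  | zero => intro f h _ _ hb he; exact key hb he
  | succ n ih =>
    intro f h hf hh hb he
    refine ⟨key hb.1 he, ?_⟩
    have hfn := ih hf hh hb.pred he
    have hs : ContDiff ℝ (⊤ : ℕ∞) (fun y => (-1 : ℂ) * (deriv V y * f y)) :=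
      contDiff_const.mul ((smooth_deriv hV.1).mul hf)
    refine ih (h := fun y => deriv h y + (-1 : ℂ) * (deriv V y * f y)) (smooth_deriv hf)
      ((smooth_deriv hh).add hs) (EB.add (smooth_deriv hh) hs hb.2 ?_) ?_
    · have := EB.mul contDiff_const ((smooth_deriv hV.1).mul hf) ((CE.const (-1)).2 n)
        (EB.mul (smooth_deriv hV.1) hf (hV.deriv.2 n) hfn)
      simpa only [zero_add] using this
    · intro y hy
      have := eqOn_deriv ((smooth_diff hV.1).mul (smooth_diff hf)) (smooth_diff hh) he y hy
      rw [deriv_mul (smooth_diff hV.1 y) (smooth_diff hf y)] at this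
      rw [← this]; ring

lemma CE_prim {s : ℝ} (hs : s ≠ 0) {g : ℝ → ℂ} (hg : CE s g) :
    ∃ I : ℝ → ℂ, CE s I ∧ ∀ y, HasDerivAt I (g y) y := by
  have hgc : Continuous g := hg.1.continuous
  obtain ⟨C, hC⟩ := hg.2 0
  have hC0 : 0 ≤ C := by
    have := (norm_nonneg _).trans (hC 0 le_rfl)
    simpa using this
  suffices h : ∃ I : ℝ → ℂ, EB0 s I ∧ ∀ y, HasDerivAt I (g y) y by
    obtain ⟨I, h0, h1⟩ := h
    have : deriv I = g := funext fun y => (h1 y).deriv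
    exact ⟨I, CE.of_deriv (fun y => (h1 y).differentiableAt) h0 (this ▸ hg), h1⟩
  have hd : ∀ y, HasDerivAt (fun y => ∫ x in (0:ℝ)..y, g x) (g y) y := fun y =>
    intervalIntegral.integral_hasDerivAt_right (hgc.intervalIntegrable _ _)
      hgc.stronglyMeasurable.stronglyMeasurableAtFilter hgc.continuousAt
  rcases lt_or_gt_of_ne hs with hs | hs
  · have hexp : ∀ y, IntegrableOn (fun x => C * Real.exp (s * x)) (Ioi y) := fun y =>
      (integrableOn_exp_mul_Ioi hs y).const_mul C
    have hint : ∀ y, 0 ≤ y → IntegrableOn g (Ioi y) := fun y hy =>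
      (hexp y).mono' hgc.aestronglyMeasurable
        ((ae_restrict_mem measurableSet_Ioi).mono fun x hx => hC x (hy.trans (le_of_lt hx)))
    refine ⟨fun y => (∫ x in (0:ℝ)..y, g x) - ∫ x in Ioi (0:ℝ), g x, ⟨C * (-s)⁻¹, fun y hy => ?_⟩,
      fun y => (hd y).sub_const _⟩
    have e : (∫ x in (0:ℝ)..y, g x) - ∫ x in Ioi (0:ℝ), g x = - ∫ x in Ioi y, g x := by
      rw [← intervalIntegral.integral_interval_add_Ioi (hint 0 le_rfl) (hint y hy)]; ring
    show ‖(∫ x in (0:ℝ)..y, g x) - ∫ x in Ioi (0:ℝ), g x‖ ≤ _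
    rw [e, norm_neg]
    calc ‖∫ x in Ioi y, g x‖ ≤ ∫ x in Ioi y, C * Real.exp (s * x) :=
          norm_integral_le_of_norm_le (hexp y)
            ((ae_restrict_mem measurableSet_Ioi).mono fun x hx => hC x (hy.trans (le_of_lt hx)))
      _ = _ := by
          rw [integral_const_mul, integral_exp_mul_Ioi hs]
          field_simp
  · refine ⟨fun y => ∫ x in (0:ℝ)..y, g x, ⟨C * s⁻¹, fun y hy => ?_⟩, hd⟩
    calc ‖∫ x in (0:ℝ)..y, g x‖ ≤ ∫ x in (0:ℝ)..y, C * Real.exp (s * x) :=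
          intervalIntegral.norm_integral_le_of_norm_le hy
            (Eventually.of_forall fun x hx => hC x hx.1.le)
            (Continuous.intervalIntegrable (by fun_prop) _ _)
      _ = C * (s⁻¹ * (Real.exp (s * y) - 1)) := by
          rw [intervalIntegral.integral_const_mul, intervalIntegral.integral_comp_mul_left _ hs.ne',
            integral_exp]
          simp
      _ ≤ _ := by
          rw [mul_assoc]
          gcongr
          linarith

lemma EB0_of_tendsto {s : ℝ} {f : ℝ → ℂ} (hf : Continuous f) {A : ℂ}
    (h : Tendsto (fun y : ℝ => ((Real.exp (-(s * y)) : ℝ) : ℂ) * f y) atTop (nhds A)) :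
    EB0 s f := by
  have hb := (h.norm).eventually (eventually_le_nhds (lt_add_one ‖A‖))
  obtain ⟨R, hR⟩ := eventually_atTop.1 hb
  have hcont : Continuous (fun y : ℝ => ((Real.exp (-(s * y)) : ℝ) : ℂ) * f y) := by fun_prop
  obtain ⟨M, hM⟩ := (isCompact_Icc (a := (0:ℝ)) (b := R)).exists_bound_of_continuousOn
    hcont.continuousOn
  refine ⟨max M (‖A‖ + 1), fun y hy => ?_⟩
  have : ‖((Real.exp (-(s * y)) : ℝ) : ℂ) * f y‖ ≤ max M (‖A‖ + 1) := by
    rcases le_total y R with h1 | h1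
    · exact (hM y ⟨hy, h1⟩).trans (le_max_left _ _)
    · exact (hR y h1).trans (le_max_right _ _)
  rw [norm_mul, Complex.norm_real, Real.norm_of_nonneg (Real.exp_pos _).le, Real.exp_neg,
    ← div_eq_inv_mul, div_le_iff₀ (Real.exp_pos _)] at this
  exact this

/-- if `f → A` and `f' → L` then `L = 0` -/
lemma deriv_lim_zero {f f' : ℝ → ℂ} (hf : ∀ y, HasDerivAt f (f' y) y) {A L : ℂ}
    (h : Tendsto f atTop (nhds A)) (h' : Tendsto f' atTop (nhds L)) : L = 0 := by
  have h1 : Tendsto (fun y => f (y + 1) - f y - L) atTop (nhds (A - A - L)) :=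
    ((h.comp (tendsto_atTop_add_const_right atTop (1:ℝ) tendsto_id)).sub h).sub_const L
  have h2 : Tendsto (fun y => f (y + 1) - f y - L) atTop (nhds 0) := by
    rw [Metric.tendsto_atTop] at h' ⊢
    intro ε hε
    obtain ⟨R, hR⟩ := h' (ε / 2) (by linarith)
    refine ⟨R, fun y hy => ?_⟩
    have hm := (convex_Icc y (y + 1)).norm_image_sub_le_of_norm_hasDerivWithin_le
      (f := fun x => f x - (x : ℂ) * L) (f' := fun x => f' x - L) (C := ε / 2)
      (fun x _ => by
        have := (hf x).fun_sub ((Complex.ofRealCLM.hasDerivAt (x := x)).mul_const L)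
        simpa using this.hasDerivWithinAt)
      (fun x hx => by rw [← dist_eq_norm]; exact (hR x (hy.trans hx.1)).le)
      (left_mem_Icc.2 (by linarith)) (right_mem_Icc.2 (by linarith : y ≤ y + 1))
    rw [dist_zero_right]
    have e : f (y + 1) - f y - L = f (y + 1) - ((y + 1 : ℝ) : ℂ) * L - (f y - (y : ℂ) * L) := by
      push_cast; ring
    rw [e]
    refine hm.trans_lt ?_
    simp; linarith
  have := tendsto_nhds_unique h1 h2
  simpa using this

lemma asymp_deriv {s : ℝ} {f : ℝ → ℂ} (hf : Differentiable ℝ f) {A B : ℂ}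
    (h : Tendsto (fun y : ℝ => ((Real.exp (-(s * y)) : ℝ) : ℂ) * f y) atTop (nhds A))
    (h' : Tendsto (fun y : ℝ => ((Real.exp (-(s * y)) : ℝ) : ℂ) * deriv f y) atTop (nhds B)) :
    B = s * A := by
  have hd : ∀ y, HasDerivAt (fun y : ℝ => ((Real.exp (-(s * y)) : ℝ) : ℂ) * f y)
      (((Real.exp (-(s * y)) : ℝ) : ℂ) * deriv f y - s * (((Real.exp (-(s * y)) : ℝ) : ℂ) * f y))
      y := by
    intro y
    have h1 : HasDerivAt (fun y : ℝ => Real.exp (-(s * y))) (Real.exp (-(s * y)) * (-(s * 1))) y :=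
      (((hasDerivAt_id y).const_mul s).neg).exp
    have := h1.ofReal_comp.mul (hf y).hasDerivAt
    refine this.congr_deriv ?_
    push_cast; ring
  have := deriv_lim_zero hd h (h'.sub (h.const_mul (s : ℂ)))
  exact sub_eq_zero.1 this

lemma ray_solve {U : ℝ → ℝ} {α : ℝ} {c : ℂ} {φm φp V : ℝ → ℂ}
    (hVdef : V = fun y => (U y : ℂ) - (starRingEnd ℂ) c)
    (hV : CE 0 V) (hm : CE (-α) φm) (hp : CE α φp)
    (hEm : ∀ y : ℝ, 0 ≤ y → RayStar U α c φm y = 0)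
    (hEp : ∀ y : ℝ, 0 ≤ y → RayStar U α c φp y = 0) {K : ℂ} (hK : K ≠ 0)
    (hW : ∀ y : ℝ, 0 ≤ y → V y ^ 2 * (φm y * deriv φp y - deriv φm y * φp y) = K)
    {t : ℝ} (ht1 : α + t ≠ 0) (ht2 : -α + t ≠ 0) {F : ℝ → ℂ} (hF : CE t F) :
    ∃ ψ : ℝ → ℂ, CE t ψ ∧ ∀ y : ℝ, 0 ≤ y → RayStar U α c ψ y = F y := by
  have hg : CE t (fun y => K⁻¹ * (V y * F y)) := by
    have := (hV.mul hF).cmul K⁻¹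
    rwa [zero_add] at this
  obtain ⟨Ip, hIp, dIp⟩ := CE_prim ht1 (hp.mul hg)
  obtain ⟨Im, hIm, dIm⟩ := CE_prim ht2 (hm.mul hg)
  have h1 : CE t (fun y => φm y * Ip y) := by
    have := hm.mul hIp
    rwa [neg_add_cancel_left] at this
  have h2 : CE t (fun y => φp y * Im y) := by
    have := hp.mul hIm
    rwa [add_neg_cancel_left] at this
  refine ⟨fun y => (-1 : ℂ) * (φm y * Ip y) + φp y * Im y, (h1.cmul (-1)).add h2, ?_⟩
  have dm : ∀ y, HasDerivAt φm (deriv φm y) y := fun y => (smooth_diff hm.1 y).hasDerivAt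
  have dp : ∀ y, HasDerivAt φp (deriv φp y) y := fun y => (smooth_diff hp.1 y).hasDerivAt
  have dm2 : ∀ y, HasDerivAt (deriv φm) (deriv (deriv φm) y) y :=
    fun y => (smooth_diff hm.deriv.1 y).hasDerivAt
  have dp2 : ∀ y, HasDerivAt (deriv φp) (deriv (deriv φp) y) y :=
    fun y => (smooth_diff hp.deriv.1 y).hasDerivAt
  have e1 : deriv (fun y => (-1 : ℂ) * (φm y * Ip y) + φp y * Im y) =
      fun y => (-1 : ℂ) * (deriv φm y * Ip y) + deriv φp y * Im y := by
    funext y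
    have := ((((dm y).fun_mul (dIp y)).const_mul (-1 : ℂ)).fun_add ((dp y).fun_mul (dIm y))).deriv
    rw [this]; ring
  have e2 : ∀ y, deriv (fun y => (-1 : ℂ) * (deriv φm y * Ip y) + deriv φp y * Im y) y =
      (-1 : ℂ) * (deriv (deriv φm) y * Ip y) + deriv (deriv φp) y * Im y +
        (φm y * deriv φp y - deriv φm y * φp y) * (K⁻¹ * (V y * F y)) := by
    intro y
    have := ((((dm2 y).fun_mul (dIp y)).const_mul (-1 : ℂ)).fun_add
      ((dp2 y).fun_mul (dIm y))).deriv
    rw [this]; ring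
  intro y hy
  have hm0 := hEm y hy
  have hp0 := hEp y hy
  have hw := hW y hy
  have hKK : K⁻¹ * K = 1 := inv_mul_cancel₀ hK
  have hVy : V y = (U y : ℂ) - (starRingEnd ℂ) c := by rw [hVdef]
  simp only [RayStar, DeltaA] at hm0 hp0 ⊢
  rw [e1, e2]
  rw [← hVy] at hm0 hp0 ⊢
  linear_combination (-Ip y) * hm0 + Im y * hp0 + K⁻¹ * F y * hw + F y * hKK

lemma OrrStar_add {U : ℝ → ℝ} {α ν : ℝ} {c : ℂ} {f g : ℝ → ℂ} (a : ℂ)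
    (hf : ContDiff ℝ (⊤ : ℕ∞) f) (hg : ContDiff ℝ (⊤ : ℕ∞) g) (y : ℝ) :
    OrrStar U α ν c (fun x => f x + a * g x) y = OrrStar U α ν c f y + a * OrrStar U α ν c g y := by
  have key : ∀ {f g : ℝ → ℂ}, ContDiff ℝ (⊤ : ℕ∞) f → ContDiff ℝ (⊤ : ℕ∞) g →
      deriv (fun x => f x + a * g x) = fun x => deriv f x + a * deriv g x := by
    intro f g hf hg
    funext x
    exact ((smooth_diff hf x).hasDerivAt.fun_add
      ((smooth_diff hg x).hasDerivAt.const_mul a)).deriv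
  have dl : ∀ {f g : ℝ → ℂ}, ContDiff ℝ (⊤ : ℕ∞) f → ContDiff ℝ (⊤ : ℕ∞) g →
      DeltaA α (fun x => f x + a * g x) = fun x => DeltaA α f x + a * DeltaA α g x := by
    intro f g hf hg
    funext x
    unfold DeltaA
    rw [key hf hg, key (smooth_deriv hf) (smooth_deriv hg)]
    ring
  have sm : ∀ {f : ℝ → ℂ}, ContDiff ℝ (⊤ : ℕ∞) f → ContDiff ℝ (⊤ : ℕ∞) (DeltaA α f) := by
    intro f hf
    exact (smooth_deriv (smooth_deriv hf)).sub (contDiff_const.mul hf)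
  unfold OrrStar RayStar
  rw [dl hf hg, key hf hg, dl (sm hf) (sm hg)]
  ring

/-- the iterative construction, for one of the two signs -/
lemma construct {U : ℝ → ℝ} {α : ℝ} {c : ℂ} {φ : ℝ → ℂ} {s t : ℝ} (hts : t ≤ s)
    (hφ : CE s φ) (hE : ∀ y : ℝ, 0 ≤ y → RayStar U α c φ y = 0)
    (hΔ : CE t (DeltaA α φ))
    (hsolve : ∀ F : ℝ → ℂ, CE t F → ∃ ψ : ℝ → ℂ, CE t ψ ∧
      ∀ y : ℝ, 0 ≤ y → RayStar U α c ψ y = F y) :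
    ∃ ψ : ℕ → ℝ → ℂ, (∀ k, CE s (ψ k)) ∧ ∀ N, ∃ D : ℝ, 0 < D ∧ ∀ ν : ℝ, 0 < ν →
      ∀ y : ℝ, 0 ≤ y → ‖OrrStar U α ν c
        (fun x => φ x + ∑ k ∈ Finset.Icc 1 N, (ν : ℂ) ^ k * ψ k x) y‖ ≤
          D * ν ^ (N + 1) * Real.exp (s * y) := by
  let S := {f : ℝ → ℂ // CE s f ∧ CE t (DeltaA α f)}
  have step : ∀ f : S, ∃ g : S, ∀ y : ℝ, 0 ≤ y →
      RayStar U α c g.1 y = (-(1 / (Complex.I * (α : ℂ)))) * DeltaA α (DeltaA α f.1) y := by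
    intro f
    obtain ⟨ψ, h1, h2⟩ := hsolve _ ((f.2.2.delta α).cmul (-(1 / (Complex.I * (α : ℂ)))))
    exact ⟨⟨ψ, h1.mono hts, h1.delta α⟩, h2⟩
  choose nxt hnxt using step
  let Ψ : ℕ → S := fun k => Nat.rec ⟨φ, hφ, hΔ⟩ (fun _ f => nxt f) k
  have hsucc : ∀ k, Ψ (k + 1) = nxt (Ψ k) := fun k => rfl
  refine ⟨fun k => (Ψ k).1, fun k => (Ψ k).2.1, fun N => ?_⟩
  have smsum : ∀ (ν : ℝ) N, ContDiff ℝ (⊤ : ℕ∞)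
      (fun x => φ x + ∑ k ∈ Finset.Icc 1 N, (ν : ℂ) ^ k * (Ψ k).1 x) := fun ν N =>
    hφ.1.add (ContDiff.sum fun k _ => contDiff_const.mul (Ψ k).2.1.1)
  have key : ∀ ν : ℝ, ∀ y : ℝ, 0 ≤ y → ∀ N, OrrStar U α ν c
      (fun x => φ x + ∑ k ∈ Finset.Icc 1 N, (ν : ℂ) ^ k * (Ψ k).1 x) y =
        (ν : ℂ) ^ (N + 1) * ((1 / (Complex.I * (α : ℂ))) * DeltaA α (DeltaA α (Ψ N).1) y) := by
    intro ν y hy N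
    induction N with
    | zero =>
      have e : (fun x => φ x + ∑ k ∈ Finset.Icc 1 0, (ν : ℂ) ^ k * (Ψ k).1 x) = φ := by
        funext x; simp
      rw [e]
      show RayStar U α c φ y + _ = _ * (_ * DeltaA α (DeltaA α φ) y)
      rw [hE y hy]; ring
    | succ N ih =>
      have e : (fun x => φ x + ∑ k ∈ Finset.Icc 1 (N + 1), (ν : ℂ) ^ k * (Ψ k).1 x) =
          fun x => (φ x + ∑ k ∈ Finset.Icc 1 N, (ν : ℂ) ^ k * (Ψ k).1 x) +
            (ν : ℂ) ^ (N + 1) * (Ψ (N + 1)).1 x := by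
        funext x
        rw [Finset.sum_Icc_succ_top (by omega)]; ring
      rw [e, OrrStar_add _ (smsum ν N) (Ψ (N + 1)).2.1.1, ih]
      have h := hnxt (Ψ N) y hy
      rw [← hsucc] at h
      unfold OrrStar
      rw [h]; ring
  obtain ⟨D, hD⟩ := ((((Ψ N).2.1.delta α).delta α).cmul (1 / (Complex.I * (α : ℂ)))).2 0
  refine ⟨|D| + 1, by positivity, fun ν hν y hy => ?_⟩
  rw [key ν y hy, norm_mul, norm_pow, Complex.norm_real, Real.norm_of_nonneg hν.le]
  calc _ ≤ ν ^ (N + 1) * (D * Real.exp (s * y)) := by gcongr; exact hD y hy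
    _ ≤ ν ^ (N + 1) * ((|D| + 1) * Real.exp (s * y)) := by
        gcongr; linarith [le_abs_self D]
    _ = _ := by ring

lemma EB_ofReal {s : ℝ} {n : ℕ} : ∀ {g : ℝ → ℝ}, ContDiff ℝ (⊤ : ℕ∞) g →
    (∀ k, ∃ C : ℝ, ∀ y : ℝ, 0 ≤ y → |iteratedDeriv k g y| ≤ C * Real.exp (s * y)) →
    EB s n (fun y => (g y : ℂ)) := by
  have h0 : ∀ {g : ℝ → ℝ},
      (∀ k, ∃ C : ℝ, ∀ y : ℝ, 0 ≤ y → |iteratedDeriv k g y| ≤ C * Real.exp (s * y)) →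
      EB0 s (fun y => (g y : ℂ)) := by
    intro g h
    obtain ⟨C, hC⟩ := h 0
    exact ⟨C, fun y hy => by simpa using hC y hy⟩
  induction n with
  | zero => intro g _ h; exact h0 h
  | succ n ih =>
    intro g hg h
    refine ⟨h0 h, ?_⟩
    have hd := contDiff_infty_iff_deriv.1 hg
    have e : deriv (fun y => (g y : ℂ)) = fun y => ((deriv g y : ℝ) : ℂ) := by
      funext y; exact (hd.1 y).hasDerivAt.ofReal_comp.deriv
    rw [e]
    refine ih hd.2 fun k => ?_
    rw [← iteratedDeriv_succ']; exact h (k + 1)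

lemma CE_of_asymp {s : ℝ} {φ : ℝ → ℂ} (hφ : ContDiff ℝ (⊤ : ℕ∞) φ)
    (h : ∀ n : ℕ, ∃ C : ℂ, C ≠ 0 ∧
      Tendsto (fun y : ℝ => ((Real.exp (-(s * y)) : ℝ) : ℂ) * iteratedDeriv n φ y)
        atTop (nhds C)) : CE s φ := by
  refine ⟨hφ, fun n => EB_of_iter fun k => ?_⟩
  obtain ⟨C, -, hC⟩ := h k
  exact EB0_of_tendsto (hφ.continuous_iteratedDeriv k (by exact_mod_cast le_top)) hC

/-- construction of the approximate slow modes of the adjoint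
Orr-Sommerfeld operator as `ν`-power-series corrections of the adjoint Rayleigh
fundamental solutions `φ^{*,±}`, with uniform exponentially weighted bounds on the
correctors and error `O(ν^{N+1})`. -/
theorem stmt_14 (U : ℝ → ℝ) (η₀ : ℝ) (hU : ShearFlow U η₀) (α : ℝ) (hα : 0 < α) (c : ℂ)
    (hc : ∃ δ : ℝ, 0 < δ ∧ ∀ y : ℝ, 0 ≤ y → δ ≤ norm ((U y : ℂ) - c))
    (φm φp : ℝ → ℂ) (hφmS : ContDiff ℝ (⊤ : ℕ∞) φm) (hφpS : ContDiff ℝ (⊤ : ℕ∞) φp)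
    (hφmE : ∀ y : ℝ, 0 ≤ y → RayStar U α c φm y = 0)
    (hφpE : ∀ y : ℝ, 0 ≤ y → RayStar U α c φp y = 0)
    (hφmA : ∀ n : ℕ, ∃ C : ℂ, C ≠ 0 ∧
      Tendsto (fun y : ℝ => ((Real.exp (α * y) : ℝ) : ℂ) * iteratedDeriv n φm y)
        atTop (nhds C))
    (hφpA : ∀ n : ℕ, ∃ C : ℂ, C ≠ 0 ∧
      Tendsto (fun y : ℝ => ((Real.exp (-(α * y)) : ℝ) : ℂ) * iteratedDeriv n φp y)
        atTop (nhds C))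
    (N : ℕ) :
    ∃ (ψm ψp : ℕ → ℝ → ℂ) (D : ℝ) (C : ℕ → ℝ), 0 < D ∧
      (∀ k, 1 ≤ k → k ≤ N → ContDiff ℝ (⊤ : ℕ∞) (ψm k) ∧ ContDiff ℝ (⊤ : ℕ∞) (ψp k)) ∧
      (∀ j k, 1 ≤ k → k ≤ N → ∀ y : ℝ, 0 ≤ y →
        Real.exp (α * y) * norm (iteratedDeriv j (ψm k) y) ≤ C j ∧
        Real.exp (-(α * y)) * norm (iteratedDeriv j (ψp k) y) ≤ C j) ∧
      (∃ ν₁ : ℝ, 0 < ν₁ ∧ ∀ ν : ℝ, 0 < ν → ν < ν₁ → ∀ y : ℝ, 0 ≤ y →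
        norm (OrrStar U α ν c
            (fun x => φm x + ∑ k ∈ Finset.Icc 1 N, (ν : ℂ) ^ k * ψm k x) y) ≤
          D * ν ^ (N + 1) * Real.exp (-(α * y)) ∧
        norm (OrrStar U α ν c
            (fun x => φp x + ∑ k ∈ Finset.Icc 1 N, (ν : ℂ) ^ k * ψp k x) y) ≤
          D * ν ^ (N + 1) * Real.exp (α * y)) := by
  obtain ⟨hUs, ⟨M, hM⟩, -, -, -, -, hη, hUd⟩ := hU
  obtain ⟨δ, hδ, hδV⟩ := hc
  have hφmA' : ∀ n : ℕ, ∃ C : ℂ, C ≠ 0 ∧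
      Tendsto (fun y : ℝ => ((Real.exp (-((-α) * y)) : ℝ) : ℂ) * iteratedDeriv n φm y)
        atTop (nhds C) := by
    intro n
    simpa only [neg_mul, neg_neg] using hφmA n
  have hm : CE (-α) φm := CE_of_asymp hφmS hφmA'
  have hp : CE α φp := CE_of_asymp hφpS hφpA
  have hUdd := contDiff_infty_iff_deriv.1 hUs
  have hU1 : CE (-η₀) (fun y => ((deriv U y : ℝ) : ℂ)) := by
    refine ⟨Complex.ofRealCLM.contDiff.comp hUdd.2, fun n => EB_ofReal hUdd.2 fun k => ?_⟩
    obtain ⟨C, -, hC⟩ := hUd (k + 1) (by omega)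
    refine ⟨C, fun y hy => ?_⟩
    rw [← iteratedDeriv_succ']; exact hC y hy
  obtain ⟨V, hVdef⟩ : ∃ V : ℝ → ℂ, V = fun y => (U y : ℂ) - (starRingEnd ℂ) c := ⟨_, rfl⟩
  have hVd : ∀ y, HasDerivAt V ((deriv U y : ℝ) : ℂ) y := by
    intro y; rw [hVdef]
    exact (hUdd.1 y).hasDerivAt.ofReal_comp.sub_const _
  have hV : CE 0 V := by
    refine CE.of_deriv (fun y => (hVd y).differentiableAt) ⟨M + ‖c‖, fun y _ => ?_⟩ ?_
    · rw [hVdef]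
      have h1 := norm_sub_le (U y : ℂ) ((starRingEnd ℂ) c)
      have h2 := hM y
      rw [Complex.norm_real, Real.norm_eq_abs, RCLike.norm_conj] at h1
      simp only [zero_mul, Real.exp_zero, mul_one]
      linarith
    · have : deriv V = fun y => ((deriv U y : ℝ) : ℂ) := funext fun y => (hVd y).deriv
      rw [this]
      exact hU1.mono (by linarith)
  have hVδ : ∀ y, 0 ≤ y → δ ≤ ‖V y‖ := by
    intro y hy
    have h1 := hδV y hy
    have h2 : V y = (starRingEnd ℂ) ((U y : ℂ) - c) := by rw [hVdef]; simp
    rw [h2, RCLike.norm_conj]; exact h1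
  have hV0 : ∀ y, 0 ≤ y → V y ≠ 0 := by
    intro y hy h
    have := hVδ y hy
    rw [h, norm_zero] at this; linarith
  -- the Wronskian
  have dm : ∀ y, HasDerivAt φm (deriv φm y) y := fun y => (smooth_diff hm.1 y).hasDerivAt
  have dp : ∀ y, HasDerivAt φp (deriv φp y) y := fun y => (smooth_diff hp.1 y).hasDerivAt
  have dm2 : ∀ y, HasDerivAt (deriv φm) (deriv (deriv φm) y) y :=
    fun y => (smooth_diff hm.deriv.1 y).hasDerivAt
  have dp2 : ∀ y, HasDerivAt (deriv φp) (deriv (deriv φp) y) y :=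
    fun y => (smooth_diff hp.deriv.1 y).hasDerivAt
  obtain ⟨W, hWdef⟩ : ∃ W : ℝ → ℂ, W = fun y => φm y * deriv φp y - deriv φm y * φp y := ⟨_, rfl⟩
  have dW : ∀ y, 0 ≤ y → HasDerivAt (fun y => V y ^ 2 * W y) 0 y := by
    intro y hy
    have h1 := ((hVd y).fun_pow 2).fun_mul
      (((dm y).fun_mul (dp2 y)).fun_sub ((dm2 y).fun_mul (dp y)))
    rw [hWdef]
    refine h1.congr_deriv ?_
    have a := hφmE y hy
    have b := hφpE y hy
    have hVy : V y = (U y : ℂ) - (starRingEnd ℂ) c := by rw [hVdef]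
    simp only [RayStar, DeltaA] at a b
    rw [← hVy] at a b
    push_cast
    linear_combination (V y * φm y) * b - (V y * φp y) * a
  have hWc : ∀ y, 0 ≤ y → V y ^ 2 * W y = V 0 ^ 2 * W 0 := by
    intro y hy
    refine (convex_Ici (0:ℝ)).is_const_of_fderivWithin_eq_zero (𝕜 := ℝ)
      (f := fun y => V y ^ 2 * W y)
      (fun x hx => (dW x hx).differentiableAt.differentiableWithinAt) (fun x hx => ?_)
      (mem_Ici.2 hy) (mem_Ici.2 le_rfl)
    rw [fderivWithin_eq_fderiv (uniqueDiffOn_Ici 0 x hx) (dW x hx).differentiableAt]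
    ext
    simp [(dW x hx).deriv]
  have hK : V 0 ^ 2 * W 0 ≠ 0 := by
    intro hK
    obtain ⟨A, hA, tA⟩ := hφmA' 0
    obtain ⟨A', -, tA'⟩ := hφmA' 1
    obtain ⟨B, hB, tB⟩ := hφpA 0
    obtain ⟨B', -, tB'⟩ := hφpA 1
    rw [iteratedDeriv_zero] at tA tB
    rw [iteratedDeriv_one] at tA' tB'
    have eA := asymp_deriv (smooth_diff hm.1) tA tA'
    have eB := asymp_deriv (smooth_diff hp.1) tB tB'
    have lim := (tA.mul tB').sub (tA'.mul tB)
    have lim0 : Tendsto W atTop (nhds 0) := by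
      refine tendsto_const_nhds.congr' ?_
      filter_upwards [eventually_ge_atTop 0] with y hy
      have h1 := hWc y hy
      rw [hK] at h1
      exact ((mul_eq_zero.1 h1).resolve_left (pow_ne_zero 2 (hV0 y hy))).symm
    have lim1 : Tendsto W atTop (nhds (A * B' - A' * B)) := by
      refine lim.congr fun y => ?_
      have e : ((Real.exp (-(-α * y)) : ℝ) : ℂ) * ((Real.exp (-(α * y)) : ℝ) : ℂ) = 1 := by
        rw [← Complex.ofReal_mul, ← Real.exp_add]; simp
      rw [hWdef]
      linear_combination (φm y * deriv φp y - deriv φm y * φp y) * e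
    have h := tendsto_nhds_unique lim1 lim0
    rw [eA, eB] at h
    push_cast at h
    have h' : (2 * (α : ℂ)) * (A * B) = 0 := by linear_combination h
    have hα' : (α : ℂ) ≠ 0 := by exact_mod_cast hα.ne'
    exact (mul_ne_zero (mul_ne_zero two_ne_zero hα') (mul_ne_zero hA hB)) h'
  have hW : ∀ y : ℝ, 0 ≤ y → V y ^ 2 * (φm y * deriv φp y - deriv φm y * φp y) =
      V 0 ^ 2 * W 0 := by
    intro y hy
    rw [← hWc y hy, hWdef]
  -- decay of the Laplacian
  have hΔ : ∀ {s : ℝ} {φ : ℝ → ℂ}, CE s φ → (∀ y : ℝ, 0 ≤ y → RayStar U α c φ y = 0) →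
      CE (-η₀ + s) (DeltaA α φ) := by
    intro s φ hφ hE
    have h1 := (hU1.mul hφ.deriv).cmul (-2)
    refine ⟨(hφ.delta α).1, fun n => CE_div hδ hV hVδ n (hφ.delta α).1 h1.1 (h1.2 n) ?_⟩
    intro y hy
    have h2 := hE y hy
    have hVy : V y = (U y : ℂ) - (starRingEnd ℂ) c := by rw [hVdef]
    simp only [RayStar] at h2
    rw [← hVy] at h2
    linear_combination h2
  have hη1 : 0 < min η₀ α := lt_min hη hα
  have hη2 : min η₀ α ≤ η₀ := min_le_left _ _
  have hη3 : min η₀ α ≤ α := min_le_right _ _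
  obtain ⟨ψm, hψm, hOm⟩ := construct (U := U) (c := c) (t := -min η₀ α + -α) (by linarith) hm hφmE
    ((hΔ hm hφmE).mono (by linarith)) fun F hF =>
      ray_solve hVdef hV hm hp hφmE hφpE hK hW (by linarith [hη1] : _ < (0:ℝ)).ne
        (by linarith : _ < (0:ℝ)).ne hF
  obtain ⟨ψp, hψp, hOp⟩ := construct (U := U) (c := c) (t := -min η₀ α + α) (by linarith) hp hφpE
    ((hΔ hp hφpE).mono (by linarith)) fun F hF =>
      ray_solve hVdef hV hm hp hφmE hφpE hK hW (by linarith : (0:ℝ) < _).ne'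
        (by linarith : _ < (0:ℝ)).ne hF
  obtain ⟨Dm, hDm, hOm⟩ := hOm N
  obtain ⟨Dp, hDp, hOp⟩ := hOp N
  choose Cm hCm using fun j k => (hψm k).iter j
  choose Cp hCp using fun j k => (hψp k).iter j
  refine ⟨ψm, ψp, Dm + Dp, fun j => ∑ k ∈ Finset.Icc 1 N, (|Cm j k| + |Cp j k|), by positivity,
    fun k _ _ => ⟨(hψm k).1, (hψp k).1⟩, ?_, 1, one_pos, ?_⟩
  · intro j k hk1 hkN y hy
    have hle : |Cm j k| + |Cp j k| ≤ ∑ k ∈ Finset.Icc 1 N, (|Cm j k| + |Cp j k|) :=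
      Finset.single_le_sum (f := fun k => |Cm j k| + |Cp j k|) (fun i _ => by positivity)
        (Finset.mem_Icc.2 ⟨hk1, hkN⟩)
    have gen : ∀ (s r C : ℝ) (x : ℂ), r = -s → ‖x‖ ≤ C * Real.exp s → Real.exp r * ‖x‖ ≤ |C| := by
      intro s r C x hr hx
      rw [hr, Real.exp_neg, ← div_eq_inv_mul, div_le_iff₀ (Real.exp_pos _)]
      exact hx.trans (mul_le_mul_of_nonneg_right (le_abs_self C) (Real.exp_pos _).le)
    have a := gen _ (α * y) _ _ (by ring) (hCm j k y hy)
    have b := gen _ (-(α * y)) _ _ (by ring) (hCp j k y hy)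
    have a0 := abs_nonneg (Cm j k)
    have b0 := abs_nonneg (Cp j k)
    exact ⟨by linarith, by linarith⟩
  · intro ν hν _ y hy
    have a := hOm ν hν y hy
    have b := hOp ν hν y hy
    rw [neg_mul] at a
    refine ⟨a.trans ?_, b.trans ?_⟩
    · gcongr; linarith
    · gcongr; linarith
end
end

section
/- Let c₀ ∈ ℂ, κ ≥ 1 an integer, A ∈ ℂ with A ≠ 0, ν₀ > 0, U ⊆ ℂ an open neighborhood of c₀, and f : U × [0,ν₀] → ℂ such that f(·,ν) is holomorphic on U for each ν ∈ [0,ν₀]. Assume f(c,ν) = A(c−c₀)^κ + g(ν) + R(c,ν), where g : [0,ν₀] → ℂ is continuous at 0 with g(0) = 0 and g(ν) ≠ 0 for ν ≠ 0, and where for every ε > 0 there is δ > 0 such that |c−c₀| ≤ δ and 0 ≤ ν ≤ δ imply |R(c,ν)| ≤ ε·(|A|·|c−c₀|^κ + |g(ν)|). Then for every ε ∈ (0,1) there exists ν_ε ∈ (0,ν₀] such that for all ν ∈ (0,ν_ε]: the function f(·,ν) has exactly κ zeros, counted with multiplicity, in the disc {c : |c−c₀| < ((1+ε)|g(ν)|/|A|)^{1/κ}},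 and every such zero c satisfies (1−ε)|g(ν)|/|A| ≤ |c−c₀|^κ ≤ (1+ε)|g(ν)|/|A|. -/
open MeasureTheory Filter Set

noncomputable section

lemma aux_factor (c : ℂ) (R : ℝ) (hR : 0 < R) (F : ℂ → ℂ)
    (hF : AnalyticOnNhd ℂ F (Metric.closedBall c R))
    (hne : ∀ z ∈ Metric.sphere c R, F z ≠ 0) :
    ∃ (S : Finset ℂ) (m : ℂ → ℕ) (h : ℂ → ℂ),
      (∀ z ∈ S, z ∈ Metric.ball c R) ∧ (∀ z ∈ S, 1 ≤ m z) ∧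
      AnalyticOnNhd ℂ h (Metric.closedBall c R) ∧
      (∀ z ∈ Metric.closedBall c R, h z ≠ 0) ∧
      (∀ z ∈ Metric.closedBall c R,
        F =ᶠ[nhds z] fun z => (∏ s ∈ S, (z - s) ^ m s) * h z) := by
  have hconv := convex_closedBall c R
  have hpre : IsPreconnected (Metric.closedBall c R) := hconv.isPreconnected
  obtain ⟨w, hw⟩ : (Metric.sphere c R).Nonempty := NormedSpace.sphere_nonempty.2 hR.le
  have hwc : w ∈ Metric.closedBall c R := Metric.sphere_subset_closedBall hw
  have hnt : (Metric.closedBall c R).Nontrivial :=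
    ⟨w, hwc, c, Metric.mem_closedBall_self hR.le, by
      rintro rfl
      simp at hw
      exact hR.ne hw⟩
  have hperf : Preperfect (Metric.closedBall c R) := hpre.preperfect_of_nontrivial hnt
  have hmer : MeromorphicOn F (Metric.closedBall c R) := hF.meromorphicOn
  have htop : ∀ u : Metric.closedBall c R, meromorphicOrderAt F u ≠ ⊤ := by
    have hcon : IsConnected (Metric.closedBall c R) := ⟨⟨w, hwc⟩, hpre⟩
    refine (hmer.exists_meromorphicOrderAt_ne_top_iff_forall hcon).1 ⟨⟨w, hwc⟩, ?_⟩
    have := (hF w hwc).meromorphicNFAt.meromorphicOrderAt_eq_zero_iff.2 (hne w hw)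
    simp [this]
  have hfin := (MeromorphicOn.divisor F (Metric.closedBall c R)).finiteSupport
    (isCompact_closedBall c R)
  obtain ⟨h, hh, hh0, hE⟩ := hmer.extract_zeros_poles htop hfin
  have hD0 := MeromorphicOn.AnalyticOnNhd.divisor_nonneg hF
  set D := MeromorphicOn.divisor F (Metric.closedBall c R) with hD
  have hprod : (∏ᶠ u, (· - u) ^ D u : ℂ → ℂ) • h =
      fun z => (∏ s ∈ hfin.toFinset, (z - s) ^ (D s).toNat) * h z := by
    rw [Function.FactorizedRational.finprod_eq_fun hfin]
    ext z
    simp only [Pi.smul_apply', smul_eq_mul]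
    congr 1
    rw [finprod_eq_prod_of_mulSupport_subset (s := hfin.toFinset)]
    · refine Finset.prod_congr rfl fun s _ => ?_
      have : ((D s).toNat : ℤ) = D s := Int.toNat_of_nonneg (hD0 s)
      conv_lhs => rw [← this]
      rw [zpow_natCast]
    · intro u
      contrapose
      simp_all
  rw [hprod] at hE
  have hm1 : ∀ z ∈ hfin.toFinset, 1 ≤ (D z).toNat := by
    intro z hz
    have h1 : D z ≠ 0 := by simpa using hz
    have h2 : 0 ≤ D z := hD0 z
    omega
  have hev : ∀ z ∈ Metric.closedBall c R,
      F =ᶠ[nhds z] fun z => (∏ s ∈ hfin.toFinset, (z - s) ^ (D s).toNat) * h z := by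
    intro z hz
    have ha : AnalyticAt ℂ (fun z => (∏ s ∈ hfin.toFinset, (z - s) ^ (D s).toNat) * h z) z := by
      refine AnalyticAt.mul ?_ (hh z hz)
      refine Finset.analyticAt_fun_prod _ fun s _ => ?_
      fun_prop
    have h1 := (hF z hz).meromorphicAt.eventuallyEq_nhdsNE_of_eventuallyEq_codiscreteWithin_preperfect
      ha.meromorphicAt hz hperf hE
    exact ((hF z hz).frequently_eq_iff_eventually_eq ha).1 h1.frequently
  refine ⟨hfin.toFinset, fun s => (D s).toNat, h, ?_, hm1, hh, fun z hz => hh0 ⟨z, hz⟩, hev⟩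
  intro z hz
  have hzc : z ∈ Metric.closedBall c R := D.supportWithinDomain (by simpa using hz)
  have h0 : F z = 0 := by
    rw [(hev z hzc).eq_of_nhds, Finset.prod_eq_zero hz, zero_mul]
    have := hm1 z hz
    simp only [sub_self]
    exact zero_pow (by omega)
  rcases (Metric.mem_closedBall.1 hzc).lt_or_eq with h1 | h1
  · exact h1
  · exact absurd h0 (hne z h1)

lemma aux_rouche (c A : ℂ) (hA : A ≠ 0) (κ : ℕ) (R : ℝ) (hR : 0 < R) (F : ℂ → ℂ)
    (hF : AnalyticOnNhd ℂ F (Metric.closedBall c R))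
    (hlt : ∀ z ∈ Metric.sphere c R, ‖F z - A * (z - c) ^ κ‖ < ‖A * (z - c) ^ κ‖) :
    ∃ (S : Finset ℂ) (m : ℂ → ℕ) (h : ℂ → ℂ),
      (∀ z ∈ S, z ∈ Metric.ball c R) ∧ (∀ z ∈ S, 1 ≤ m z) ∧ (∑ z ∈ S, m z) = κ ∧
      DifferentiableOn ℂ h (Metric.ball c R) ∧
      (∀ z ∈ Metric.ball c R, h z ≠ 0 ∧ F z = (∏ s ∈ S, (z - s) ^ m s) * h z) := by
  have hne : ∀ z ∈ Metric.sphere c R, F z ≠ 0 := by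
    intro z hz h0
    have := hlt z hz
    simp [h0] at this
  obtain ⟨S, m, h, hS, hm, hh, hh0, hev⟩ := aux_factor c R hR F hF hne
  refine ⟨S, m, h, hS, hm, ?_, fun z hz =>
    (hh z (Metric.ball_subset_closedBall hz)).differentiableAt.differentiableWithinAt, fun z hz =>
    ⟨hh0 z (Metric.ball_subset_closedBall hz),
      (hev z (Metric.ball_subset_closedBall hz)).eq_of_nhds⟩⟩
  have hzc : ∀ z ∈ Metric.sphere c R, z - c ≠ 0 := by
    intro z hz h0
    rw [mem_sphere_iff_norm, h0] at hz
    simp at hz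
    exact hR.ne hz
  have hzs : ∀ z ∈ Metric.sphere c R, ∀ s ∈ S, z - s ≠ 0 := by
    intro z hz s hs h0
    have := hS s hs
    rw [← sub_eq_zero.1 h0, Metric.mem_ball, Metric.mem_sphere.1 hz] at this
    exact lt_irrefl _ this
  have hsub : Metric.sphere c R ⊆ Metric.closedBall c R := Metric.sphere_subset_closedBall
  -- the quotient
  have hlog : ∀ z ∈ Metric.sphere c R,
      logDeriv (fun z => F z / (A * (z - c) ^ κ)) z
        = (∑ s ∈ S, (m s : ℂ) * (z - s)⁻¹) + logDeriv h z - (κ : ℂ) * (z - c)⁻¹ := by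
    intro z hz
    have hd : ∀ (s : ℂ) (n : ℕ), logDeriv (fun z => (z - s) ^ n) z = (n : ℂ) * (z - s)⁻¹ := by
      intro s n
      rw [logDeriv_fun_pow (f := fun z => z - s) (by fun_prop)]
      simp [logDeriv_apply]
    rw [logDeriv_div (f := F) (g := fun z => A * (z - c) ^ κ) z (hne z hz) (mul_ne_zero hA (pow_ne_zero _ (hzc z hz)))
      (hF z (hsub hz)).differentiableAt (by fun_prop), logDeriv_const_mul z A hA, hd,
      logDeriv_congr_nhds (hev z (hsub hz)) |>.eq_of_nhds,
      logDeriv_mul (f := fun z => ∏ s ∈ S, (z - s) ^ m s) z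
        (Finset.prod_ne_zero_iff.2 fun s hs => pow_ne_zero _ (hzs z hz s hs)) (hh0 z (hsub hz))
        (by fun_prop) (hh z (hsub hz)).differentiableAt,
      logDeriv_prod (f := fun s z => (z - s) ^ m s) (fun s hs => pow_ne_zero _ (hzs z hz s hs))
        (fun s _ => by fun_prop)]
    simp only [hd]
  have hI0 : (∮ z in C(c, R), logDeriv (fun z => F z / (A * (z - c) ^ κ)) z) = 0 := by
    refine circleIntegral.integral_eq_zero_of_hasDerivWithinAt
      (f := fun z => Complex.log (F z / (A * (z - c) ^ κ))) hR.le fun z hz => ?_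
    have hw : A * (z - c) ^ κ ≠ 0 := mul_ne_zero hA (pow_ne_zero _ (hzc z hz))
    have hq : DifferentiableAt ℂ (fun z => F z / (A * (z - c) ^ κ)) z :=
      (hF z (hsub hz)).differentiableAt.div (by fun_prop) hw
    refine (hq.hasDerivAt.clog ?_).hasDerivWithinAt
    have : F z / (A * (z - c) ^ κ) = 1 + (F z - A * (z - c) ^ κ) / (A * (z - c) ^ κ) := by
      rw [sub_div, div_self hw]
      ring
    rw [this]
    apply Complex.mem_slitPlane_of_norm_lt_one
    rw [norm_div, div_lt_one (norm_pos_iff.2 hw)]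
    exact hlt z hz
  rw [circleIntegral.integral_congr hR.le hlog] at hI0
  have hi : ∀ s ∈ Metric.ball c R, ∀ n : ℕ,
      CircleIntegrable (fun z => (n : ℂ) * (z - s)⁻¹) c R := by
    intro s hs n
    refine ContinuousOn.circleIntegrable hR.le ?_
    refine continuousOn_const.mul (ContinuousOn.inv₀ (by fun_prop) fun z hz h0 => ?_)
    rw [← sub_eq_zero.1 h0, Metric.mem_ball, Metric.mem_sphere.1 hz] at hs
    exact lt_irrefl _ hs
  have hld : AnalyticOnNhd ℂ (logDeriv h) (Metric.closedBall c R) := fun z hz =>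
    (hh z hz).deriv.div (hh z hz) (hh0 z hz)
  have hild : CircleIntegrable (logDeriv h) c R :=
    ContinuousOn.circleIntegrable hR.le (hld.continuousOn.mono hsub)
  have hIh : (∮ z in C(c, R), logDeriv h z) = 0 :=
    Complex.circleIntegral_eq_zero_of_differentiable_on_off_countable hR.le countable_empty
      hld.continuousOn fun z hz => (hld z (Metric.ball_subset_closedBall hz.1)).differentiableAt
  have his : CircleIntegrable (fun z => ∑ s ∈ S, (m s : ℂ) * (z - s)⁻¹) c R :=
    CircleIntegrable.fun_sum S fun s hs => hi s (hS s hs) _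
  rw [circleIntegral.integral_sub (f := fun z => (∑ s ∈ S, (m s : ℂ) * (z - s)⁻¹) + logDeriv h z)
      (his.add hild) (hi c (Metric.mem_ball_self hR) κ),
    circleIntegral.integral_add his hild, hIh,
    circleIntegral.integral_fun_sum fun s hs => hi s (hS s hs) _] at hI0
  simp only [circleIntegral.integral_const_mul] at hI0
  rw [circleIntegral.integral_sub_inv_of_mem_ball (Metric.mem_ball_self hR),
    Finset.sum_congr rfl fun s hs => by
      rw [circleIntegral.integral_sub_inv_of_mem_ball (hS s hs)], ← Finset.sum_mul, add_zero,
    ← sub_mul] at hI0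
  have h2 : (2 * (Real.pi : ℂ) * Complex.I) ≠ 0 := Complex.two_pi_I_ne_zero
  have h3 := sub_eq_zero.1 ((mul_eq_zero.1 hI0).resolve_right h2)
  exact_mod_cast h3

theorem stmt_18 (c₀ A : ℂ) (κ : ℕ) (hκ : 1 ≤ κ) (hA : A ≠ 0) (ν₀ : ℝ) (hν₀ : 0 < ν₀)
    (Uset : Set ℂ) (hUopen : IsOpen Uset) (hc₀U : c₀ ∈ Uset)
    (f : ℂ → ℝ → ℂ) (g : ℝ → ℂ)
    (hf : ∀ ν : ℝ, 0 ≤ ν → ν ≤ ν₀ → DifferentiableOn ℂ (fun c => f c ν) Uset)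
    (hg0 : g 0 = 0) (hgcont : ContinuousWithinAt g (Set.Icc 0 ν₀) 0)
    (hgne : ∀ ν : ℝ, 0 < ν → ν ≤ ν₀ → g ν ≠ 0)
    (hR : ∀ ε : ℝ, 0 < ε → ∃ δ : ℝ, 0 < δ ∧ ∀ (c : ℂ) (ν : ℝ), c ∈ Uset →
      ‖c - c₀‖ ≤ δ → 0 ≤ ν → ν ≤ δ → ν ≤ ν₀ →
      ‖f c ν - A * (c - c₀) ^ κ - g ν‖ ≤
        ε * (‖A‖ * ‖c - c₀‖ ^ κ + ‖g ν‖)) :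
    ∀ ε : ℝ, 0 < ε → ε < 1 → ∃ νε : ℝ, 0 < νε ∧ νε ≤ ν₀ ∧
      ∀ ν : ℝ, 0 < ν → ν ≤ νε →
        ∃ R : ℝ, R = ((1 + ε) * ‖g ν‖ / ‖A‖) ^ ((1 : ℝ) / κ) ∧
          Metric.ball c₀ R ⊆ Uset ∧
          ∃ (S : Finset ℂ) (m : ℂ → ℕ) (h : ℂ → ℂ),
            (∀ z ∈ S, z ∈ Metric.ball c₀ R) ∧
            (∀ z ∈ S, 1 ≤ m z) ∧
            (∑ z ∈ S, m z) = κ ∧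
            DifferentiableOn ℂ h (Metric.ball c₀ R) ∧
            (∀ z ∈ Metric.ball c₀ R, h z ≠ 0 ∧
              f z ν = (∏ s ∈ S, (z - s) ^ m s) * h z) ∧
            (∀ z ∈ S,
              (1 - ε) * ‖g ν‖ / ‖A‖ ≤ ‖z - c₀‖ ^ κ ∧
              ‖z - c₀‖ ^ κ ≤ (1 + ε) * ‖g ν‖ / ‖A‖) := by
  intro ε hε hε1
  obtain ⟨δ, hδ, hRδ⟩ := hR (ε / 4) (by linarith)
  obtain ⟨r, hr, hrU⟩ := Metric.isOpen_iff.1 hUopen c₀ hc₀U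
  set ρ := min δ (r / 2) with hρ
  have hρ0 : 0 < ρ := lt_min hδ (by linarith)
  have hA0 : 0 < ‖A‖ := norm_pos_iff.2 hA
  have hκ0 : κ ≠ 0 := by omega
  obtain ⟨η, hη, hgη⟩ := Metric.continuousWithinAt_iff.1 hgcont (ρ ^ κ * ‖A‖ / 2) (by positivity)
  refine ⟨min ν₀ (min δ (η / 2)), lt_min hν₀ (lt_min hδ (by linarith)), min_le_left _ _, ?_⟩
  intro ν hν hνle
  have hν1 : ν ≤ ν₀ := hνle.trans (min_le_left _ _)
  have hν2 : ν ≤ δ := hνle.trans ((min_le_right _ _).trans (min_le_left _ _))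
  have hν3 : ν ≤ η / 2 := hνle.trans ((min_le_right _ _).trans (min_le_right _ _))
  have hgs : ‖g ν‖ < ρ ^ κ * ‖A‖ / 2 := by
    have := hgη (x := ν) ⟨hν.le, hν1⟩ (by
      rw [Real.dist_eq, sub_zero, abs_of_pos hν]; linarith)
    simpa [hg0] using this
  have hg1 : 0 < ‖g ν‖ := norm_pos_iff.2 (hgne ν hν hν1)
  set T := (1 + ε) * ‖g ν‖ / ‖A‖ with hT
  have hT0 : 0 < T := by positivity
  set R := T ^ ((1 : ℝ) / κ) with hRdef
  have hR0 : 0 < R := Real.rpow_pos_of_pos hT0 _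
  have hRκ : R ^ κ = T := by
    rw [hRdef, one_div]
    exact Real.rpow_inv_natCast_pow hT0.le hκ0
  have hTA : ‖A‖ * T = (1 + ε) * ‖g ν‖ := by
    rw [hT]; field_simp
  have hRρ : R ≤ ρ := by
    refine le_of_pow_le_pow_left₀ hκ0 hρ0.le ?_
    rw [hRκ, hT, div_le_iff₀ hA0]
    nlinarith
  have hcb : Metric.closedBall c₀ R ⊆ Uset := by
    refine (Metric.closedBall_subset_ball ?_).trans hrU
    have : ρ ≤ r / 2 := min_le_right _ _
    linarith
  have hbd : ∀ z ∈ Metric.closedBall c₀ R, ‖f z ν - A * (z - c₀) ^ κ - g ν‖ ≤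
        ε / 4 * (‖A‖ * ‖z - c₀‖ ^ κ + ‖g ν‖) := by
    intro z hz
    refine hRδ z ν (hcb hz) ?_ hν.le hν2 hν1
    have : ρ ≤ δ := min_le_left _ _
    exact (mem_closedBall_iff_norm.1 hz).trans (hRρ.trans this)
  have hFan : AnalyticOnNhd ℂ (fun c => f c ν) (Metric.closedBall c₀ R) :=
    ((hf ν hν.le hν1).analyticOnNhd hUopen).mono hcb
  have hlt : ∀ z ∈ Metric.sphere c₀ R,
      ‖f z ν - A * (z - c₀) ^ κ‖ < ‖A * (z - c₀) ^ κ‖ := by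
    intro z hz
    have h1 := hbd z (Metric.sphere_subset_closedBall hz)
    rw [mem_sphere_iff_norm.1 hz, hRκ, hTA] at h1
    rw [norm_mul, norm_pow, mem_sphere_iff_norm.1 hz, hRκ, hTA]
    have h2 : ‖f z ν - A * (z - c₀) ^ κ‖ ≤ ‖f z ν - A * (z - c₀) ^ κ - g ν‖ + ‖g ν‖ := by
      simpa using norm_add_le (f z ν - A * (z - c₀) ^ κ - g ν) (g ν)
    have h3 : 0 < ε * ‖g ν‖ := by positivity
    nlinarith
  obtain ⟨S, m, h, hS, hm, hsum, hd, hfac⟩ := aux_rouche c₀ A hA κ R hR0 (fun c => f c ν) hFan hlt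
  refine ⟨R, rfl, Metric.ball_subset_closedBall.trans hcb, S, m, h, hS, hm, hsum, hd, hfac, ?_⟩
  intro z hz
  have hzb := hS z hz
  constructor
  · have h0 : f z ν = 0 := by
      have h1 := (hfac z hzb).2
      rw [h1, Finset.prod_eq_zero hz, zero_mul]
      have := hm z hz
      simp only [sub_self]
      exact zero_pow (by omega)
    have h1 := hbd z (Metric.ball_subset_closedBall hzb)
    rw [h0] at h1
    have h2 : ‖g ν‖ ≤ ‖0 - A * (z - c₀) ^ κ - g ν‖ + ‖A‖ * ‖z - c₀‖ ^ κ := by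
      have := norm_add_le (0 - A * (z - c₀) ^ κ - g ν) (A * (z - c₀) ^ κ)
      rw [norm_mul, norm_pow] at this
      have he : 0 - A * (z - c₀) ^ κ - g ν + A * (z - c₀) ^ κ = -g ν := by ring
      rwa [he, norm_neg] at this
    rw [div_le_iff₀ hA0]
    have ht : 0 ≤ ‖A‖ * ‖z - c₀‖ ^ κ := by positivity
    set t := ‖A‖ * ‖z - c₀‖ ^ κ
    have h3 : (1 - ε / 4) * ‖g ν‖ ≤ (1 + ε / 4) * t := by linarith
    have h4 : (1 + ε / 4) * ((1 - ε) * ‖g ν‖) ≤ (1 - ε / 4) * ‖g ν‖ := by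
      rw [← mul_assoc]
      refine mul_le_mul_of_nonneg_right ?_ hg1.le
      nlinarith
    have h5 := le_of_mul_le_mul_left (h4.trans h3) (by linarith)
    rw [mul_comm]
    linarith [mul_comm (‖z - c₀‖ ^ κ) ‖A‖]
  · rw [← hRκ]
    exact pow_le_pow_left₀ (norm_nonneg _) (mem_ball_iff_norm.1 hzb).le _
end
end

section
/- Let U_s : [0,∞) → ℝ be measurable, c ∈ ℂ with Im c > 0 and inf_{y≥0}|U_s(y) − c| > 0, and let φ : [0,∞) → ℂ be measurable with φ ∈ L¹([0,∞)) ∩ L²([0,∞)) and φ not almost everywhere zero. Let ε ≥ 0 and let r : [0,∞) → ℂ be measurable with |r(y)| ≤ ε for all y ≥ 0. If ε·∫₀^∞|φ(y)|dy < Im c · ∫₀^∞ |φ(y)|²/|U_s(y) − c|² dy, then ∫₀^∞ φ(y)·( conj(φ(y))/(U_s(y) − conj(c)) + r(y) ) dy ≠ 0. -/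
open MeasureTheory Filter Set

noncomputable section

/-- nonvanishing of the pairing between an eigenmode and the perturbed
adjoint eigenmode: if `ε ∫|φ| < Im c ∫ |φ|²/|U−c|²` and `|r| ≤ ε` on `[0,∞)`, then
`∫₀^∞ φ (conj φ/(U − conj c) + r) ≠ 0`. -/
theorem stmt_19 (U : ℝ → ℝ) (hU : Measurable U) (c : ℂ) (hc : 0 < c.im)
    (hinf : ∃ δ : ℝ, 0 < δ ∧ ∀ y : ℝ, 0 ≤ y → δ ≤ ‖(U y : ℂ) - c‖)
    (φ : ℝ → ℂ) (hφm : Measurable φ)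
    (hφ1 : Integrable φ (volume.restrict (Set.Ioi (0 : ℝ))))
    (hφ2 : MemLp φ 2 (volume.restrict (Set.Ioi (0 : ℝ))))
    (hφne : ¬ (∀ᵐ y ∂(volume.restrict (Set.Ioi (0 : ℝ))), φ y = 0))
    (ε : ℝ) (hε : 0 ≤ ε) (r : ℝ → ℂ) (hr : Measurable r)
    (hrb : ∀ y : ℝ, 0 ≤ y → ‖r y‖ ≤ ε)
    (hkey : ε * (∫ y in Set.Ioi (0 : ℝ), ‖φ y‖) <
      c.im * ∫ y in Set.Ioi (0 : ℝ),
        ‖φ y‖ ^ 2 / ‖(U y : ℂ) - c‖ ^ 2) :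
    (∫ y in Set.Ioi (0 : ℝ),
      φ y * ((starRingEnd ℂ) (φ y) / ((U y : ℂ) - (starRingEnd ℂ) c) + r y)) ≠ 0 := by
  intro h0
  have him : ∀ y, c.im ≤ ‖(U y : ℂ) - (starRingEnd ℂ) c‖ := fun y => by
    have h := Complex.abs_im_le_norm ((U y : ℂ) - (starRingEnd ℂ) c)
    simp only [Complex.sub_im, Complex.ofReal_im, Complex.conj_im] at h
    exact (le_abs_self _).trans (by simpa using h)
  have hsq : Integrable (fun y => ‖φ y‖ ^ 2) (volume.restrict (Set.Ioi (0 : ℝ))) :=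
    (memLp_two_iff_integrable_sq_norm hφm.aestronglyMeasurable).1 hφ2
  have hf : Integrable (fun y => φ y * ((starRingEnd ℂ) (φ y) / ((U y : ℂ) - (starRingEnd ℂ) c)))
      (volume.restrict (Set.Ioi (0 : ℝ))) := by
    refine (hsq.div_const c.im).mono' ?_ (ae_of_all _ fun y => ?_)
    · have hconj : Measurable (fun y => (starRingEnd ℂ) (φ y)) :=
        Complex.continuous_conj.measurable.comp hφm
      have hUc : Measurable (fun y => (U y : ℂ)) := Complex.measurable_ofReal.comp hU
      exact (hφm.mul (hconj.div (hUc.sub_const _))).aestronglyMeasurable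
    · rw [norm_mul, norm_div, RCLike.norm_conj, ← mul_div_assoc, ← sq]
      exact div_le_div_of_nonneg_left (by positivity) hc (him y)
  have hrae : ∀ᵐ y ∂(volume.restrict (Set.Ioi (0 : ℝ))), ‖φ y * r y‖ ≤ ε * ‖φ y‖ := by
    filter_upwards [ae_restrict_mem measurableSet_Ioi] with y hy
    rw [norm_mul, mul_comm]
    exact mul_le_mul_of_nonneg_right (hrb y (le_of_lt hy)) (norm_nonneg _)
  have hg : Integrable (fun y => φ y * r y) (volume.restrict (Set.Ioi (0 : ℝ))) :=
    (hφ1.norm.const_mul ε).mono' (hφm.mul hr).aestronglyMeasurable hrae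
  have hb : ‖∫ y in Set.Ioi (0 : ℝ), φ y * r y‖ ≤ ε * ∫ y in Set.Ioi (0 : ℝ), ‖φ y‖ := by
    rw [← integral_const_mul]
    exact norm_integral_le_of_norm_le (hφ1.norm.const_mul ε) hrae
  simp only [mul_add] at h0
  rw [integral_add hf hg] at h0
  have h1 : (∫ y in Set.Ioi (0 : ℝ),
      φ y * ((starRingEnd ℂ) (φ y) / ((U y : ℂ) - (starRingEnd ℂ) c))).im =
      -c.im * ∫ y in Set.Ioi (0 : ℝ), ‖φ y‖ ^ 2 / ‖(U y : ℂ) - c‖ ^ 2 := by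
    rw [← integral_const_mul]
    refine (integral_im hf).symm.trans (integral_congr_ae (ae_of_all _ fun y => ?_))
    show (φ y * ((starRingEnd ℂ) (φ y) / ((U y : ℂ) - (starRingEnd ℂ) c))).im =
      -c.im * (‖φ y‖ ^ 2 / ‖(U y : ℂ) - c‖ ^ 2)
    rw [← mul_div_assoc, Complex.mul_conj, Complex.div_im, Complex.sq_norm, Complex.sq_norm]
    have : Complex.normSq ((U y : ℂ) - (starRingEnd ℂ) c) = Complex.normSq ((U y : ℂ) - c) := by
      simp [Complex.normSq_apply]
    rw [this]
    simp
    ring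
  have h2 := congrArg Complex.im h0
  rw [Complex.add_im, h1, Complex.zero_im] at h2
  have h3 := (le_abs_self _).trans
    (Complex.abs_im_le_norm (∫ y in Set.Ioi (0 : ℝ), φ y * r y))
  linarith
end
end
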